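/- (Aharoni–Berger) For every digraph D and vertex sets X, Y, there is a system P of pairwise disjoint X→Y paths in D such that one can choose exactly one vertex from each path in P in such a way that the resulting vertex set S separates Y from X in D, i.e., S meets every X→Y path of D. -/

import Mathlib

namespace FlamePaper

universe u
variable {V : Type u}

/-- A (nonempty, repetition-free) directed path, given by the list of its vertices;
its edge set consists of the pairs of consecutive vertices. A one-vertex list is the
trivial `v→v` path. -/
structure DiPath (V : Type u) where
  verts : List V
  ne : verts ≠ []
  nodup : verts.Nodup

namespace DiPath
variable (P : DiPath V)
def first : V := P.verts.head P.ne
def last : V := P.verts.getLast P.ne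
def vertexSet : Set V := {x | x ∈ P.verts}
def edges : Set (V × V) := {e | e ∈ P.verts.zip P.verts.tail}
def internal : Set V := P.vertexSet \ {P.first, P.last}
/-- The last edge of `P` (as a set; empty for the trivial path). -/
def lastEdge : Set (V × V) := {e ∈ P.edges | e.2 = P.last}
end DiPath

/-- `P` is a path of the digraph `D`. -/
def IsPathIn (D : Set (V × V)) (P : DiPath V) : Prop := P.edges ⊆ D

/-- `P` is an `a→b` path in `D`. -/
def IsPath (D : Set (V × V)) (a b : V) (P : DiPath V) : Prop :=
  IsPathIn D P ∧ P.first = a ∧ P.last = b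

/-- The set of ingoing edges of `v` in `D`. -/
def inEdges (D : Set (V × V)) (v : V) : Set (V × V) := {e ∈ D | e.2 = v}

/-- The set of outgoing edges of `v` in `D`. -/
def outEdges (D : Set (V × V)) (v : V) : Set (V × V) := {e ∈ D | e.1 = v}

/-- A rooted digraph: the root has no ingoing edges. -/
def IsRooted (D : Set (V × V)) (r : V) : Prop := inEdges D r = ∅

/-- `Ps` is a system of internally disjoint `r→v` paths in `D`: any two distinct
members share exactly the vertices `r` and `v`. -/
def IntDisjSystem (D : Set (V × V)) (r v : V) (Ps : Set (DiPath V)) : Prop :=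
  (∀ P ∈ Ps, IsPath D r v P) ∧
  ∀ P ∈ Ps, ∀ Q ∈ Ps, P ≠ Q → P.vertexSet ∩ Q.vertexSet = {r, v}

/-- `A_last(Ps)`: the set of last edges of the paths in `Ps`. -/
def lastEdges (Ps : Set (DiPath V)) : Set (V × V) := ⋃ P ∈ Ps, P.lastEdge

/-- `𝒢_D(v)`: the set of those `I ⊆ in_D(v)` which arise as the set of last edges
of a system of internally disjoint `r→v` paths of `D`. -/
def GSet (D : Set (V × V)) (r v : V) : Set (Set (V × V)) :=
  {I | ∃ Ps, IntDisjSystem D r v Ps ∧ lastEdges Ps = I}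

/-- `Ps ∈ ℑ_D(v)`: an internally disjoint system of `r→v` paths of `D` from each member
of which one can choose either an internal vertex or an edge so that the resulting set
meets every `r→v` path of `D`. -/
def EMSystem (D : Set (V × V)) (r v : V) (Ps : Set (DiPath V)) : Prop :=
  IntDisjSystem D r v Ps ∧
  ∃ sel : DiPath V → V ⊕ (V × V),
    (∀ P ∈ Ps, (∀ x, sel P = Sum.inl x → x ∈ P.internal) ∧
              (∀ e, sel P = Sum.inr e → e ∈ P.edges)) ∧
    ∀ Q : DiPath V, IsPath D r v Q →
      ∃ P ∈ Ps, (∀ x, sel P = Sum.inl x → x ∈ Q.vertexSet) ∧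
               (∀ e, sel P = Sum.inr e → e ∈ Q.edges)

/-- The path-system `Ps` lies in `L`. -/
def LiesIn (Ps : Set (DiPath V)) (L : Set (V × V)) : Prop := ∀ P ∈ Ps, IsPathIn L P

/-- `L` is a `D`-vertex-large spanning subdigraph of `D`. -/
def IsLarge (D L : Set (V × V)) (r : V) : Prop :=
  L ⊆ D ∧ ∀ v, v ≠ r → ∃ Ps, EMSystem D r v Ps ∧ LiesIn Ps L

/-- `F` is a vertex-flame with root `r`. -/
def IsFlame (F : Set (V × V)) (r : V) : Prop :=
  ∀ v, v ≠ r → inEdges F v ∈ GSet F r v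

/-- `F` is a quasi-vertex-flame with root `r`. -/
def IsQuasiFlame (F : Set (V × V)) (r : V) : Prop :=
  ∀ v, v ≠ r → ∀ I ⊆ inEdges F v, I.Finite → I ∈ GSet F r v

/-- `S` separates `b` from `a` in `D`: every `a→b` path of `D` meets `S`. -/
def Separates (D : Set (V × V)) (a b : V) (S : Set V) : Prop :=
  ∀ P : DiPath V, IsPath D a b P → (P.vertexSet ∩ S).Nonempty

/-- `𝔖_D(v)`: the Erdős–Menger separations corresponding to `v`. -/
def SepSet (D : Set (V × V)) (r v : V) : Set (Set V) :=
  {S | r ∉ S ∧ v ∉ S ∧ Separates (D \ {(r, v)}) r v S ∧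
    ∃ Ps, IntDisjSystem D r v Ps ∧
      ∃ sel : DiPath V → V, (∀ P ∈ Ps, sel P ∈ P.internal) ∧ S = sel '' Ps}

/-- The entrance of `X` with respect to `D`. -/
def entrance (D : Set (V × V)) (X : Set V) : Set V :=
  {v ∈ X | ∃ u, u ∉ X ∧ (u, v) ∈ D}

/-- `int_D(X) = X ∖ ent_D(X)`. -/
def interiorSet (D : Set (V × V)) (X : Set V) : Set V := X \ entrance D X

/-- `B` is a `v`-bubble of `D` (with root `r`): `B ⊆ V − r` and there is a `v`-infan
`{P_u : u ∈ ent_D(B)}` in `D ∩ (B × B)` where `P_u` starts at `u`. -/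
def IsBubble (D : Set (V × V)) (r v : V) (B : Set V) : Prop :=
  r ∉ B ∧
  ∃ F : V → DiPath V,
    (∀ u ∈ entrance D B, IsPath (D ∩ B ×ˢ B) u v (F u)) ∧
    ∀ u ∈ entrance D B, ∀ u' ∈ entrance D B, u ≠ u' →
      (F u).vertexSet ∩ (F u').vertexSet = {v}

/-- `bubb_D(v)`. -/
def bubbles (D : Set (V × V)) (r v : V) : Set (Set V) := {B | IsBubble D r v B}

/-- `B_{v,D}`: the union of all `v`-bubbles of `D`. -/
def maxBubble (D : Set (V × V)) (r v : V) : Set V := ⋃₀ bubbles D r v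

/-- `B_{S,v,D}`: the set of vertices `u` such that every `r→u` path of `D−rv` meets `S`. -/
def Bset (D : Set (V × V)) (r v : V) (S : Set V) : Set V :=
  {u | ∀ P : DiPath V, IsPath (D \ {(r, v)}) r u P → (P.vertexSet ∩ S).Nonempty}

/-- `Ps` is an `r`-fan in `D`: paths of `D` starting at `r`, any two distinct members
having only the vertex `r` in common. -/
def IsRFan (D : Set (V × V)) (r : V) (Ps : Set (DiPath V)) : Prop :=
  (∀ P ∈ Ps, IsPathIn D P ∧ P.first = r) ∧
  ∀ P ∈ Ps, ∀ Q ∈ Ps, P ≠ Q → P.vertexSet ∩ Q.vertexSet = {r}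

/-- The set of first vertices of the paths in `Ps`. -/
def Vfirst (Ps : Set (DiPath V)) : Set V := DiPath.first '' Ps

/-- The set of last vertices of the paths in `Ps`. -/
def Vlast (Ps : Set (DiPath V)) : Set V := DiPath.last '' Ps

/-- `P` is an `X→Y` path in `D`: exactly its first vertex lies in `X` and
exactly its last vertex lies in `Y`. -/
def IsXYPath (D : Set (V × V)) (X Y : Set V) (P : DiPath V) : Prop :=
  IsPathIn D P ∧ P.vertexSet ∩ X = {P.first} ∧ P.vertexSet ∩ Y = {P.last}

/-- `Ps` is a system of pairwise (vertex-)disjoint `X→Y` paths of `D`. -/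
def DisjXYSystem (D : Set (V × V)) (X Y : Set V) (Ps : Set (DiPath V)) : Prop :=
  (∀ P ∈ Ps, IsXYPath D X Y P) ∧
  ∀ P ∈ Ps, ∀ Q ∈ Ps, P ≠ Q → P.vertexSet ∩ Q.vertexSet = ∅

/-- `κ_D(r,v)`: the maximum size of a (finite) system of internally disjoint `r→v`
paths of `D`. -/
noncomputable def kappa (D : Set (V × V)) (r v : V) : ℕ :=
  sSup {n : ℕ | ∃ Ps : Set (DiPath V), IntDisjSystem D r v Ps ∧ Ps.Finite ∧ Ps.ncard = n}

section

open Cardinal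

variable {D : V → V → Prop} {Y Z R : Set V} {f : V → V}

/-- `v` is `u` or an out-neighbour of `u`. -/
def Adj (D : V → V → Prop) (u v : V) : Prop := u = v ∨ D u v

/-- The closed out-neighbourhood of `R`. -/
def nbr (D : V → V → Prop) (R : Set V) : Set V := {v | ∃ u ∈ R, Adj D u v}

/-- A wave region `R` with its linking function `f`.  Vertices of `Y` may not be entered and
vertices of `Z` need not be covered, so that `Z \ Y` are the sources of the web, `Y \ Z` its
targets and `Y ∩ Z` is deleted.  The function `f` assigns to each vertex to be covered its
predecessor. -/
structure IsWave (D : V → V → Prop) (Y Z R : Set V) (f : V → V) : Prop where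
  disj : ∀ u ∈ R, u ∉ Y
  maps : ∀ v ∈ nbr D R, v ∉ Z → f v ∈ R
  adj : ∀ v ∈ nbr D R, v ∉ Z → Adj D (f v) v
  inj : ∀ v ∈ nbr D R, v ∉ Z → ∀ w ∈ nbr D R, w ∉ Z → f v = f w → v = w
  noRay : ∀ g : ℕ → V, g.Injective → (∀ n, g n ∈ nbr D R ∧ g n ∉ Z ∧ g (n + 1) = f (g n)) → False

/-- Some wave does not use all of its region. -/
def Hindered (D : V → V → Prop) (Y Z : Set V) : Prop :=
  ∃ R f, IsWave D Y Z R f ∧ ∃ u ∈ R, ∀ v ∈ nbr D R, v ∉ Z → f v ≠ u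

/-- The union of all wave regions. -/
def waveMax (D : V → V → Prop) (Y Z : Set V) : Set V := {u | ∃ R f, IsWave D Y Z R f ∧ u ∈ R}

theorem subset_nbr (D : V → V → Prop) (R : Set V) : R ⊆ nbr D R := fun u hu => ⟨u, hu, Or.inl rfl⟩

theorem nbr_mono (D : V → V → Prop) {R R' : Set V} (h : R ⊆ R') : nbr D R ⊆ nbr D R' :=
  fun _ ⟨u, hu, huv⟩ => ⟨u, h hu, huv⟩

theorem nbr_iUnion {ι : Sort*} (D : V → V → Prop) (R : ι → Set V) :
    nbr D (⋃ i, R i) = ⋃ i, nbr D (R i) := by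
  ext v
  simp only [nbr, Set.mem_iUnion, Set.mem_ofPred_eq]
  constructor
  · rintro ⟨u, ⟨i, hi⟩, h⟩
    exact ⟨i, u, hi, h⟩
  · rintro ⟨i, u, hi, h⟩
    exact ⟨u, ⟨i, hi⟩, h⟩

theorem nbr_union (D : V → V → Prop) (R R' : Set V) :
    nbr D (R ∪ R') = nbr D R ∪ nbr D R' := by
  ext v
  simp only [nbr, Set.mem_union, Set.mem_ofPred_eq]
  constructor
  · rintro ⟨u, h | h, h'⟩
    exacts [Or.inl ⟨u, h, h'⟩, Or.inr ⟨u, h, h'⟩]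
  · rintro (⟨u, h, h'⟩ | ⟨u, h, h'⟩)
    exacts [⟨u, Or.inl h, h'⟩, ⟨u, Or.inr h, h'⟩]

theorem nat_antitone_eventually_const {α : Type*} [LinearOrder α] [WellFoundedLT α] (a : ℕ → α)
    (h : ∀ n, a (n + 1) ≤ a n) : ∃ n, ∀ m, n ≤ m → a m = a n := by
  obtain ⟨_, ⟨n, rfl⟩, hn⟩ := WellFounded.has_min (wellFounded_lt (α := α)) (Set.range a)
    (Set.range_nonempty a)
  exact ⟨n, fun m hm => le_antisymm (antitone_nat_of_succ_le h hm) (not_lt.1 (hn _ ⟨m, rfl⟩))⟩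

/-- A ray of a function `f` whose tail is a ray of the wave yields a contradiction. -/
theorem IsWave.noRay_tail (h : IsWave D Y Z R f) {g : ℕ → V} (hg : g.Injective) (N : ℕ)
    (hN : ∀ n, N ≤ n → g n ∈ nbr D R ∧ g n ∉ Z ∧ g (n + 1) = f (g n)) : False := by
  refine h.noRay (fun n => g (n + N)) (fun a b hab => by simpa using hg hab) fun n => ?_
  have := hN (n + N) (by omega)
  simpa [add_right_comm] using this

theorem IsWave.congr {Y' Z' : Set V} (h : IsWave D Y Z R f) (hY : ∀ u ∈ R, u ∉ Y')
    (hZ : ∀ v ∈ nbr D R, v ∉ Z' → v ∉ Z) : IsWave D Y' Z' R f where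
  disj := hY
  maps v hv hz := h.maps v hv (hZ v hv hz)
  adj v hv hz := h.adj v hv (hZ v hv hz)
  inj v hv hz w hw hz' := h.inj v hv (hZ v hv hz) w hw (hZ w hw hz')
  noRay g hg hr := h.noRay g hg fun n => ⟨(hr n).1, hZ _ (hr n).1 (hr n).2.1, (hr n).2.2⟩

theorem IsWave.mono {Y' Z' : Set V} (h : IsWave D Y Z R f) (hY : ∀ u ∈ R, u ∉ Y') (hZ : Z ⊆ Z') :
    IsWave D Y' Z' R f :=
  h.congr hY fun _ _ hz hh => hz (hZ hh)

theorem Hindered.mono {Y' Z' : Set V} (h : Hindered D Y Z) (hY : Y' ⊆ Y) (hZ : Z ⊆ Z') :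
    Hindered D Y' Z' := by
  obtain ⟨R, f, hw, u, hu, hs⟩ := h
  exact ⟨R, f, hw.mono (fun v hv hv' => hw.disj v hv (hY hv')) hZ, u, hu,
    fun v hv hz => hs v hv fun hh => hz (hZ hh)⟩

theorem nbr_empty (D : V → V → Prop) : nbr D ∅ = ∅ := by
  ext v
  simp [nbr]

theorem isWave_empty : IsWave D Y Z ∅ f where
  disj := by simp
  maps := by simp [nbr_empty]
  adj := by simp [nbr_empty]
  inj := by simp [nbr_empty]
  noRay g _ hr := by simpa [nbr_empty] using (hr 0).1

/-- An arbitrary union of wave regions is a wave region. -/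
theorem IsWave.iUnion {ι : Type*} {R : ι → Set V} {f : ι → V → V}
    (h : ∀ i, IsWave D Y Z (R i) (f i)) : ∃ f', IsWave D Y Z (⋃ i, R i) f' := by
  classical
  rcases isEmpty_or_nonempty ι with hι | hι
  · rw [Set.iUnion_of_empty]
    exact ⟨id, isWave_empty⟩
  obtain ⟨_, hwo⟩ := exists_wellFoundedLT ι
  have key : ∀ v, ∃ i, v ∈ nbr D (⋃ i, R i) → v ∈ nbr D (R i) ∧ ∀ j, v ∈ nbr D (R j) → i ≤ j := by
    intro v
    by_cases hv : v ∈ nbr D (⋃ i, R i)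
    · rw [nbr_iUnion, Set.mem_iUnion] at hv
      obtain ⟨i, hi, hmin⟩ := WellFounded.has_min hwo.wf {i | v ∈ nbr D (R i)} hv
      exact ⟨i, fun _ => ⟨hi, fun j hj => not_lt.1 (hmin j hj)⟩⟩
    · exact ⟨hι.some, fun h => absurd h hv⟩
  choose I hI using key
  have hsub : ∀ i, R i ⊆ ⋃ i, R i := fun i => Set.subset_iUnion R i
  refine ⟨fun v => f (I v) v, ?_, ?_, ?_, ?_, ?_⟩
  · intro u hu
    obtain ⟨i, hi⟩ := Set.mem_iUnion.1 hu
    exact (h i).disj u hi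
  · intro v hv hz
    exact hsub _ ((h (I v)).maps v (hI v hv).1 hz)
  · intro v hv hz
    exact (h (I v)).adj v (hI v hv).1 hz
  · intro v hv hz w hw hz' he
    have h1 := (h (I v)).maps v (hI v hv).1 hz
    have h2 := (h (I w)).maps w (hI w hw).1 hz'
    have a1 := (h (I v)).adj v (hI v hv).1 hz
    have a2 := (h (I w)).adj w (hI w hw).1 hz'
    have l1 : I v ≤ I w := (hI v hv).2 _ ⟨_, h2, he ▸ a1⟩
    have l2 : I w ≤ I v := (hI w hw).2 _ ⟨_, h1, he ▸ a2⟩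
    have e := le_antisymm l1 l2
    refine (h (I v)).inj v (hI v hv).1 hz w (e ▸ (hI w hw).1) hz' ?_
    rw [he, e]
  · intro g hg hr
    obtain ⟨N, hN⟩ := nat_antitone_eventually_const (fun n => I (g n)) fun n => by
      refine (hI _ (hr (n+1)).1).2 _ (subset_nbr D _ ?_)
      rw [(hr n).2.2]
      exact (h (I (g n))).maps _ (hI _ (hr n).1).1 (hr n).2.1
    refine (h (I (g N))).noRay_tail hg N fun n hn => ?_
    have e := hN n hn
    exact ⟨e ▸ (hI _ (hr n).1).1, (hr n).2.1, by rw [(hr n).2.2, ← e]⟩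

theorem exists_isWave_waveMax (D : V → V → Prop) (Y Z : Set V) :
    ∃ f, IsWave D Y Z (waveMax D Y Z) f := by
  have := IsWave.iUnion (D := D) (Y := Y) (Z := Z)
    (ι := {p : Set V × (V → V) // IsWave D Y Z p.1 p.2}) (R := fun p => p.1.1)
    (f := fun p => p.1.2) fun p => p.2
  rwa [show waveMax D Y Z = ⋃ i : {p : Set V × (V → V) // IsWave D Y Z p.1 p.2}, i.1.1 by
    ext u
    simp [waveMax]]

theorem IsWave.subset_waveMax (h : IsWave D Y Z R f) : R ⊆ waveMax D Y Z :=
  fun _ hu => ⟨R, f, h, hu⟩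

open Classical in
/-- A wave followed by a wave of the quotient is a wave. -/
theorem IsWave.comp {R' : Set V} {f' : V → V} (h : IsWave D Y Z R f)
    (h' : IsWave D (Y ∪ R) (Z ∪ nbr D R) R' f') :
    IsWave D Y Z (R ∪ R') (fun v => if v ∈ nbr D R then f v else f' v) := by
  have maps2 : ∀ v ∈ nbr D (R ∪ R'), v ∉ Z → v ∉ nbr D R → v ∈ nbr D R' ∧ v ∉ Z ∪ nbr D R := by
    intro v hv hz hn
    rw [nbr_union] at hv
    exact ⟨hv.resolve_left hn, by simp [hz, hn]⟩
  refine ⟨?_, ?_, ?_, ?_, ?_⟩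
  · rintro u (hu | hu)
    exacts [h.disj u hu, fun hy => h'.disj u hu (Or.inl hy)]
  · intro v hv hz
    split_ifs with hn
    · exact Or.inl (h.maps v hn hz)
    · exact Or.inr (h'.maps v (maps2 v hv hz hn).1 (maps2 v hv hz hn).2)
  · intro v hv hz
    split_ifs with hn
    · exact h.adj v hn hz
    · exact h'.adj v (maps2 v hv hz hn).1 (maps2 v hv hz hn).2
  · intro v hv hz w hw hz'
    split_ifs with hn hn' hn'
    · exact h.inj v hn hz w hn' hz'
    · intro he
      obtain ⟨h1, h2⟩ := maps2 w hw hz' hn'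
      exact absurd (Or.inr (he ▸ h.maps v hn hz)) (h'.disj _ (h'.maps w h1 h2))
    · intro he
      obtain ⟨h1, h2⟩ := maps2 v hv hz hn
      exact absurd (Or.inr (he ▸ h.maps w hn' hz')) (h'.disj _ (h'.maps v h1 h2))
    · obtain ⟨h1, h2⟩ := maps2 v hv hz hn
      obtain ⟨h3, h4⟩ := maps2 w hw hz' hn'
      exact h'.inj v h1 h2 w h3 h4
  · intro g hg hr
    by_cases hN : ∃ N, g N ∈ nbr D R
    · obtain ⟨N, hN⟩ := hN
      have : ∀ n, N ≤ n → g n ∈ nbr D R := by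
        intro n hn
        induction n, hn using Nat.le_induction with
        | base => exact hN
        | succ n _ ih =>
          rw [(hr n).2.2]
          rw [if_pos ih]
          exact subset_nbr D R (h.maps _ ih (hr n).2.1)
      refine h.noRay_tail hg N fun n hn => ⟨this n hn, (hr n).2.1, ?_⟩
      rw [(hr n).2.2, if_pos (this n hn)]
    · push Not at hN
      refine h'.noRay g hg fun n => ?_
      obtain ⟨h1, h2⟩ := maps2 _ (hr n).1 (hr n).2.1 (hN n)
      exact ⟨h1, h2, by rw [(hr n).2.2, if_neg (hN n)]⟩

/-- Removing from a wave a set which is not used to reach the vertices still to be covered. -/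
theorem IsWave.diff {S Y' Z' : Set V} (h : IsWave D Y Z R f)
    (hY : ∀ u ∈ R, u ∉ S → u ∉ Y') (hZ : Z ⊆ Z')
    (hS : ∀ v ∈ nbr D R, v ∉ Z' → f v ∉ S) : IsWave D Y' Z' (R \ S) f where
  disj u hu := hY u hu.1 hu.2
  maps v hv hz :=
    have hv' := nbr_mono D Set.sdiff_subset hv
    ⟨h.maps v hv' fun hh => hz (hZ hh), hS v hv' hz⟩
  adj v hv hz := h.adj v (nbr_mono D Set.sdiff_subset hv) fun hh => hz (hZ hh)
  inj v hv hz w hw hz' := h.inj v (nbr_mono D Set.sdiff_subset hv) (fun hh => hz (hZ hh)) w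
    (nbr_mono D Set.sdiff_subset hw) (fun hh => hz' (hZ hh))
  noRay g hg hr := h.noRay g hg fun n =>
    ⟨nbr_mono D Set.sdiff_subset (hr n).1, fun hh => (hr n).2.1 (hZ hh), (hr n).2.2⟩

/-- The quotient by the largest wave has no nonempty wave. -/
theorem eq_empty_of_isWave_quotient {R' : Set V} {f' : V → V}
    (h' : IsWave D (Y ∪ waveMax D Y Z) (Z ∪ nbr D (waveMax D Y Z)) R' f') : R' = ∅ := by
  obtain ⟨f, h⟩ := exists_isWave_waveMax D Y Z
  rw [Set.eq_empty_iff_forall_notMem]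
  intro u hu
  exact h'.disj u hu (Or.inr ((h.comp h').subset_waveMax (Or.inr hu)))

theorem not_hindered_quotient :
    ¬ Hindered D (Y ∪ waveMax D Y Z) (Z ∪ nbr D (waveMax D Y Z)) := by
  rintro ⟨R, f, h, u, hu, -⟩
  rw [eq_empty_of_isWave_quotient h] at hu
  exact hu

/-- The vertices reachable from `E` by alternating walks. -/
inductive Reach (D : V → V → Prop) (Z : Set V) (f : V → V) (E : Set V) : V → Prop
  | base (u : V) : u ∈ E → Reach D Z f E u
  | step (w v : V) : Reach D Z f E w → Adj D w v → v ∉ Z → Reach D Z f E (f v)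

theorem Reach.mem (h : IsWave D Y Z R f) {E : Set V} (hE : E ⊆ R) {w : V}
    (hw : Reach D Z f E w) : w ∈ R := by
  induction hw with
  | base u hu => exact hE hu
  | step w v _ ha hz ih => exact h.maps v ⟨w, ih, ha⟩ hz

theorem IsWave.reach (h : IsWave D Y Z R f) {E : Set V} (hE : E ⊆ R) :
    IsWave D Y Z {w | Reach D Z f E w} f := by
  have hsub : {w | Reach D Z f E w} ⊆ R := fun w hw => Reach.mem h hE hw
  refine ⟨fun u hu => h.disj u (hsub hu), ?_, fun v hv => h.adj v (nbr_mono D hsub hv),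
    fun v hv hz w hw => h.inj v (nbr_mono D hsub hv) hz w (nbr_mono D hsub hw),
    fun g hg hr => h.noRay g hg fun n => ⟨nbr_mono D hsub (hr n).1, (hr n).2⟩⟩
  rintro v ⟨w, hw, ha⟩ hz
  exact Reach.step w v hw ha hz

open Classical in
/-- The states of an augmentation: `g` arises from `f` by changing it on the finite set `T`,
in such a way that `w` is not used anymore but `u` is. -/
inductive Shift (D : V → V → Prop) (Z : Set V) (f : V → V) (u : V) :
    Set V → (V → V) → V → Prop
  | base : Shift D Z f u ∅ f u
  | step (T : Set V) (g : V → V) (w v : V) : Shift D Z f u T g w → Adj D w v → v ∉ Z → v ∉ T →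
      Shift D Z f u (insert v T) (Function.update g v w) (f v)

theorem Shift.of_mem {u : V} {T : Set V} {g : V → V} {w : V} (h : Shift D Z f u T g w)
    {v : V} (hv : v ∈ T) : ∃ T' g', Shift D Z f u T' g' (f v) := by
  induction h with
  | base => exact absurd hv (by simp)
  | step T g w v' h1 ha hz hT ih =>
    rcases hv with rfl | hv
    · exact ⟨_, _, Shift.step T g w v h1 ha hz hT⟩
    · exact ih hv

theorem Reach.exists_shift {u w : V} (h : Reach D Z f {u} w) : ∃ T g, Shift D Z f u T g w := by
  induction h with
  | base u' hu =>
    obtain rfl : u' = u := hu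
    exact ⟨_, _, Shift.base⟩
  | step w v _ ha hz ih =>
    obtain ⟨T, g, hs⟩ := ih
    by_cases hv : v ∈ T
    · exact hs.of_mem hv
    · exact ⟨_, _, Shift.step T g w v hs ha hz hv⟩

theorem Shift.spec (h : IsWave D Y Z R f) {u : V} (hu : u ∈ R)
    (hs : ∀ v ∈ nbr D R, v ∉ Z → f v ≠ u) {T : Set V} {g : V → V} {w : V}
    (hS : Shift D Z f u T g w) :
    T.Finite ∧ (∀ t ∈ T, t ∈ nbr D R ∧ t ∉ Z) ∧ (∀ v, v ∉ T → g v = f v) ∧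
    (w = u ∨ ∃ t ∈ T, w = f t) ∧ (∀ v ∈ T, g v = u ∨ ∃ t ∈ T, g v = f t) ∧
    w ∈ R ∧ (∀ v ∈ nbr D R, v ∉ Z → g v ∈ R ∧ Adj D (g v) v ∧ g v ≠ w) ∧
    (∀ v ∈ nbr D R, v ∉ Z → ∀ v' ∈ nbr D R, v' ∉ Z → g v = g v' → v = v') := by
  classical
  induction hS with
  | base =>
    refine ⟨Set.finite_empty, by simp, by simp, by simp, by simp, hu, fun v hv hz =>
      ⟨h.maps v hv hz, h.adj v hv hz, hs v hv hz⟩, fun v hv hz v' hv' hz' he => h.inj v hv hz v' hv' hz' he⟩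
  | step T g w v _ ha hz hT ih =>
    obtain ⟨h1, h2, h3, h4, h5, h6, h7, h8⟩ := ih
    have hv : v ∈ nbr D R := ⟨w, h6, ha⟩
    have hgv := h3 v hT
    refine ⟨h1.insert v, ?_, ?_, ?_, ?_, h.maps v hv hz, ?_, ?_⟩
    · rintro t (rfl | ht)
      exacts [⟨hv, hz⟩, h2 t ht]
    · intro x hx
      simp only [Set.mem_insert_iff, not_or] at hx
      rw [Function.update_of_ne hx.1, h3 x hx.2]
    · exact Or.inr ⟨v, Or.inl rfl, rfl⟩
    · intro x hx
      by_cases hxv : x = v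
      · subst hxv
        rw [Function.update_self]
        rcases h4 with h4 | ⟨t, ht, h4⟩
        exacts [Or.inl h4, Or.inr ⟨t, Or.inr ht, h4⟩]
      · rw [Function.update_of_ne hxv]
        rcases h5 x (hx.resolve_left hxv) with h4 | ⟨t, ht, h4⟩
        exacts [Or.inl h4, Or.inr ⟨t, Or.inr ht, h4⟩]
    · intro x hx hxz
      by_cases hxv : x = v
      · subst hxv
        rw [Function.update_self]
        exact ⟨h6, ha, fun he => (h7 x hx hxz).2.2 (by rw [hgv, ← he])⟩
      · rw [Function.update_of_ne hxv]
        refine ⟨(h7 x hx hxz).1, (h7 x hx hxz).2.1, fun he => hxv ?_⟩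
        exact h8 x hx hxz v hv hz (by rw [he, hgv])
    · intro x hx hxz y hy hyz he
      by_cases hxv : x = v <;> by_cases hyv : y = v
      · rw [hxv, hyv]
      · subst hxv
        rw [Function.update_self, Function.update_of_ne hyv] at he
        exact absurd he.symm (h7 y hy hyz).2.2
      · subst hyv
        rw [Function.update_self, Function.update_of_ne hxv] at he
        exact absurd he (h7 x hx hxz).2.2
      · rw [Function.update_of_ne hxv, Function.update_of_ne hyv] at he
        exact h8 x hx hxz y hy hyz he

/-- Augmenting a wave from the unused vertex `u` so that `z` gets covered too. -/
theorem IsWave.augment (h : IsWave D Y Z R f) {u z : V} (hu : u ∈ R)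
    (hs : ∀ v ∈ nbr D R, v ∉ Z → f v ≠ u) (hz : z ∈ Z)
    (hzn : z ∈ nbr D {w | Reach D Z f {u} w}) :
    ∃ (T : Set V) (f' : V → V), T.Finite ∧ (∀ t ∈ T, t ∈ nbr D R ∧ t ∉ Z) ∧
      IsWave D Y (Z \ {z}) R f' ∧ (∀ v, v ∉ T → v ≠ z → f' v = f v) ∧
      (∀ v, v ∈ T ∨ v = z → f' v = u ∨ ∃ t ∈ T, f' v = f t) := by
  classical
  obtain ⟨w, hw, ha⟩ := hzn
  obtain ⟨T, g, hS⟩ := Reach.exists_shift hw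
  obtain ⟨h1, h2, h3, h4, h5, h6, h7, h8⟩ := hS.spec h hu hs
  have hzT : z ∉ T := fun hh => (h2 z hh).2 hz
  have hZ : ∀ v, v ∉ Z \ {z} → v ≠ z → v ∉ Z := fun v hv hvz hh => hv ⟨hh, hvz⟩
  refine ⟨T, Function.update g z w, h1, h2, ⟨h.disj, ?_, ?_, ?_, ?_⟩, ?_, ?_⟩
  · intro v hv hvz
    by_cases hvz' : v = z
    · subst hvz'
      rwa [Function.update_self]
    · rw [Function.update_of_ne hvz']
      exact (h7 v hv (hZ v hvz hvz')).1
  · intro v hv hvz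
    by_cases hvz' : v = z
    · subst hvz'
      rwa [Function.update_self]
    · rw [Function.update_of_ne hvz']
      exact (h7 v hv (hZ v hvz hvz')).2.1
  · intro x hx hxz y hy hyz he
    by_cases hxv : x = z <;> by_cases hyv : y = z
    · rw [hxv, hyv]
    · subst hxv
      rw [Function.update_self, Function.update_of_ne hyv] at he
      exact absurd he.symm (h7 y hy (hZ y hyz hyv)).2.2
    · subst hyv
      rw [Function.update_self, Function.update_of_ne hxv] at he
      exact absurd he (h7 x hx (hZ x hxz hxv)).2.2
    · rw [Function.update_of_ne hxv, Function.update_of_ne hyv] at he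
      exact h8 x hx (hZ x hxz hxv) y hy (hZ y hyz hyv) he
  · intro k hk hr
    have hfin : {n | k n ∈ insert z T}.Finite := (h1.insert z).preimage hk.injOn
    obtain ⟨N, hN⟩ := hfin.bddAbove
    refine h.noRay_tail hk (N + 1) fun n hn => ?_
    have hn' : k n ∉ insert z T := fun hh => by
      have := hN hh
      omega
    simp only [Set.mem_insert_iff, not_or] at hn'
    refine ⟨(hr n).1, hZ _ (hr n).2.1 hn'.1, ?_⟩
    rw [(hr n).2.2, Function.update_of_ne hn'.1, h3 _ hn'.2]
  · intro v hv hvz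
    rw [Function.update_of_ne hvz, h3 v hv]
  · intro v hv
    by_cases hvz : v = z
    · subst hvz
      rw [Function.update_self]
      exact h4
    · rw [Function.update_of_ne hvz]
      exact h5 v (hv.resolve_right hvz)

/-- If no longer covering `y` makes the web hindered, then some wave reaches `y`. -/
theorem exists_isWave_of_hindered_insert {y : V} (h : ¬ Hindered D Y Z) (hy : y ∉ Z)
    (hh : Hindered D Y (Z ∪ {y})) : ∃ R f, IsWave D Y Z R f ∧ y ∈ nbr D R := by
  obtain ⟨R, f, hw, u, hu, hs⟩ := hh
  have hw' := hw.reach (E := {u}) (by simpa using hu)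
  have hur : u ∈ {w | Reach D (Z ∪ {y}) f {u} w} := Reach.base u rfl
  have hsub : {w | Reach D (Z ∪ {y}) f {u} w} ⊆ R :=
    fun w hh => Reach.mem hw (by simpa using hu) hh
  by_cases hyn : y ∈ nbr D {w | Reach D (Z ∪ {y}) f {u} w}
  · obtain ⟨T, f', -, -, hf', -, -⟩ := hw.augment hu hs (Or.inr rfl) hyn
    rw [show (Z ∪ {y}) \ {y} = Z by ext v; by_cases hv : v = y <;> simp [hv, hy]] at hf'
    exact ⟨R, f', hf', nbr_mono D hsub hyn⟩
  · have key : ∀ v ∈ nbr D {w | Reach D (Z ∪ {y}) f {u} w}, v ∉ Z → v ∉ Z ∪ {y} := by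
      rintro v hv hz (hh | rfl)
      exacts [hz hh, hyn hv]
    exact absurd ⟨_, f, hw'.congr hw'.disj key, u, hur, fun v hv hz =>
      hs v (nbr_mono D hsub hv) (key v hv hz)⟩ h

/-- A wave leaving more vertices unused than additional vertices uncovered is a hindrance. -/
theorem hindered_of_card_lt (Q : Finset V) : ∀ {R : Set V} {f : V → V} (E : Finset V),
    IsWave D Y (Z ∪ Q) R f → ↑E ⊆ R →
    (∀ e ∈ E, ∀ v ∈ nbr D R, v ∉ Z ∪ Q → f v ≠ e) → Q.card < E.card → Hindered D Y Z := by
  classical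
  induction Q using Finset.induction_on with
  | empty =>
    intro R f E h hE hs hc
    obtain ⟨e, he⟩ := Finset.card_pos.1 hc
    simp only [Finset.coe_empty, Set.union_empty] at h hs
    exact ⟨R, f, h, e, hE he, hs e he⟩
  | insert q Q hq ih =>
    intro R f E h hE hs hc
    rw [Finset.card_insert_of_notMem hq] at hc
    by_cases hqn : ∃ e ∈ E, q ∈ nbr D {w | Reach D (Z ∪ ↑(insert q Q)) f {e} w}
    · obtain ⟨e, he, hqn⟩ := hqn
      obtain ⟨T, f', -, hT, hf', h1, h2⟩ := h.augment (hE he) (hs e he) (by simp) hqn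
      have hsub : (Z ∪ ↑(insert q Q)) \ {q} ⊆ Z ∪ (Q : Set V) := by
        rintro v ⟨hv | hv, hvq⟩
        · exact Or.inl hv
        · simp only [Finset.coe_insert, Set.mem_insert_iff] at hv
          exact Or.inr (hv.resolve_left hvq)
      refine ih (E.erase e) (hf'.mono hf'.disj hsub)
        (fun x hx => hE (Finset.mem_of_mem_erase hx)) ?_ (by
          rw [Finset.card_erase_of_mem he]
          omega)
      intro x hx v hv hz heq
      rw [Finset.mem_erase] at hx
      by_cases hvT : v ∈ T ∨ v = q
      · rcases h2 v hvT with h2 | ⟨t, ht, h2⟩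
        · exact hx.1 (by rw [← heq, h2])
        · exact hs x hx.2 t (hT t ht).1 (hT t ht).2 (by rw [← h2, heq])
      · rw [not_or] at hvT
        refine hs x hx.2 v hv ?_ (by rw [← heq, h1 v hvT.1 hvT.2])
        rintro (hh | hh)
        · exact hz (Or.inl hh)
        · simp only [Finset.coe_insert, Set.mem_insert_iff] at hh
          exact hz (Or.inr (hh.resolve_left hvT.2))
    · push Not at hqn
      have hw := h.reach hE
      have hsub : {w | Reach D (Z ∪ ↑(insert q Q)) f ↑E w} ⊆ R := fun w hh => Reach.mem h hE hh
      have hqn' : q ∉ nbr D {w | Reach D (Z ∪ ↑(insert q Q)) f ↑E w} := by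
        rintro ⟨w, hw, ha⟩
        have : ∃ e ∈ E, Reach D (Z ∪ ↑(insert q Q)) f {e} w := by
          clear ha
          induction hw with
          | base e he => exact ⟨e, he, Reach.base e rfl⟩
          | step w v _ ha hz ih =>
            obtain ⟨e, he, ih⟩ := ih
            exact ⟨e, he, Reach.step w v ih ha hz⟩
        obtain ⟨e, he, hr⟩ := this
        exact hqn e he ⟨w, hr, ha⟩
      have key : ∀ v ∈ nbr D {w | Reach D (Z ∪ ↑(insert q Q)) f ↑E w}, v ∉ Z ∪ (Q : Set V) →
          v ∉ Z ∪ ↑(insert q Q) := by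
        rintro v hv hz (hh | hh)
        · exact hz (Or.inl hh)
        · simp only [Finset.coe_insert, Set.mem_insert_iff] at hh
          rcases hh with rfl | hh
          exacts [hqn' hv, hz (Or.inr hh)]
      exact ih E (hw.congr hw.disj key) (fun e he => Reach.base e he)
        (fun e he v hv hz => hs e he v (nbr_mono D hsub hv) (key v hv hz)) (by omega)

/-- Transfinite recursion along a well-order for a relational specification. -/
theorem exists_of_wellFoundedLT {I : Type*} {α : Type*} [LinearOrder I] [WellFoundedLT I]
    [Nonempty α] (P : I → (I → α) → α → Prop)
    (hcongr : ∀ i g g' a, (∀ j < i, g j = g' j) → P i g a → P i g' a)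
    (hex : ∀ i g, (∀ j < i, P j g (g j)) → ∃ a, P i g a) : ∃ g, ∀ i, P i g (g i) := by
  classical
  let F : ∀ i, (∀ j, j < i → α) → α := fun i r =>
    Classical.epsilon fun a => P i (fun j => if h : j < i then r j h else Classical.arbitrary α) a
  have wf : WellFounded (fun a b : I => a < b) := wellFounded_lt
  refine ⟨wf.fix F, fun i => ?_⟩
  induction i using wf.induction with
  | _ i ih =>
    obtain ⟨a, ha⟩ := hex i (wf.fix F) ih
    rw [wf.fix_eq]
    have hc : ∀ j < i, wf.fix F j = (fun j => if h : j < i then wf.fix F j else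
        Classical.arbitrary α) j := fun j hj => by simp [hj]
    refine hcongr i _ _ _ (fun j hj => (hc j hj).symm) ?_
    exact Classical.epsilon_spec (p := fun a => P i (fun j => if h : j < i then wf.fix F j else
      Classical.arbitrary α) a) ⟨a, hcongr i _ _ a hc ha⟩

/-- A set `M` whose deletion leaves a web hindered by the wave `H`, `f` missing `u`, together with
a possible augmentation of this wave at a vertex `z` of `M`. -/
structure Piece (V : Type u) where
  M : Set V
  H : Set V
  T : Set V
  z : Option V
  u : V
  f : V → V
  f' : V → V

structure Piece.Valid (D : V → V → Prop) (Y Z : Set V) (p : Piece V) : Prop where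
  wave : IsWave D (Y ∪ p.M) (Z ∪ p.M) p.H p.f
  wave' : IsWave D (Y ∪ p.M) ((Z ∪ p.M) \ {x | p.z = some x}) p.H p.f'
  mem : p.u ∈ p.H
  spare : p.z = none → ∀ v ∈ nbr D p.H, v ∉ Z → v ∉ p.M → p.f' v ≠ p.u
  z_mem : ∀ x, p.z = some x → x ∈ p.M ∧ x ∈ nbr D p.H ∧ x ∉ Z
  finite : p.T.Finite
  eq : ∀ v, v ∉ p.T → p.z ≠ some v → p.f' v = p.f v
  eq_or : ∀ v, v ∈ p.T ∨ p.z = some v → p.f' v = p.u ∨ ∃ t ∈ p.T, p.f' v = p.f t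

/-- The set `M` is closed with respect to the data of the piece `p`. -/
structure Piece.Closes (D : V → V → Prop) (Z : Set V) (p : Piece V) (M : Set V) : Prop where
  subset : p.M ⊆ M
  mem : p.u ∈ M
  T_subset : p.T ⊆ M
  maps : ∀ v ∈ M, p.f v ∈ M
  preimage : ∀ v ∈ nbr D p.H, v ∉ Z → v ∉ p.M → p.f v ∈ M → v ∈ M

/-- The vertices which still have to be taken care of before stage `i`. -/
def pend {I : Type*} [LT I] (D : V → V → Prop) (Z : Set V) (p : I → Piece V) (i : I) : Set V :=
  {x | x ∉ Z ∧ (∃ j < i, x ∈ nbr D (p j).H ∧ x ∈ (p j).M) ∧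
    (∀ j < i, x ∈ nbr D (p j).H → x ∈ (p j).M) ∧ ∀ j < i, (p j).z ≠ some x}

theorem Piece.Valid.mem_iff {p : Piece V} (h : p.Valid D Y Z) {M : Set V} (hM : p.Closes D Z M)
    {v : V} (hv : v ∈ nbr D p.H) (hz : v ∉ Z) :
    p.f' v ∈ M ↔ v ∈ M := by
  constructor
  · intro h1
    by_contra h2
    have h3 : v ∉ p.M := fun h4 => h2 (hM.subset h4)
    have h4 : p.z ≠ some v := fun h5 => h3 (h.z_mem v h5).1
    rw [h.eq v (fun h5 => h2 (hM.T_subset h5)) h4] at h1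
    exact h2 (hM.preimage v hv hz h3 h1)
  · intro h1
    by_cases h2 : v ∈ p.T ∨ p.z = some v
    · rcases h.eq_or v h2 with h3 | ⟨t, ht, h3⟩
      · rw [h3]
        exact hM.mem
      · rw [h3]
        exact hM.maps t (hM.T_subset ht)
    · rw [not_or] at h2
      rw [h.eq v h2.1 h2.2]
      exact hM.maps v h1

/-- A long increasing sequence of hindered deletions yields a hindrance of the whole web. -/
theorem hindered_of_pieces {I : Type u} [LinearOrder I] [WellFoundedLT I] [Nonempty I]
    (p : I → Piece V) (hV : ∀ i, (p i).Valid D Y Z)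
    (hC : ∀ i, ∀ j < i, (p j).Closes D Z (p i).M)
    (hcard : ∀ i, #(p i).M < #(Set.Ioi i))
    (hnone : ∀ i, (p i).z = none → pend D Z p i = ∅)
    (hsome : ∀ i x, (p i).z = some x → x ∈ pend D Z p i ∧
      ∀ y ∈ pend D Z p i, ∀ j < i, y ∈ (p j).M → x ∈ (p j).M) : Hindered D Y Z := by
  classical
  have hmono : ∀ i j, i ≤ j → (p i).M ⊆ (p j).M := by
    intro i j hij
    rcases hij.eq_or_lt with rfl | hij
    exacts [subset_rfl, (hC j i hij).subset]
  have hHM : ∀ i, ∀ v ∈ (p i).H, v ∉ (p i).M := fun i v hv hm => (hV i).wave.disj v hv (Or.inr hm)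
  have hpend_of_z : ∀ i x, (p i).z = some x → ∀ j, x ∈ nbr D (p j).H → x ∈ (p j).M := by
    intro i x hx j hj
    rcases lt_or_ge j i with hji | hji
    · exact (hsome i x hx).1.2.2.1 j hji hj
    · exact hmono i j hji ((hV i).z_mem x hx).1
  have hz_of_pend : ∀ x ∉ Z, ∀ j, x ∈ nbr D (p j).H →
      (∀ j, x ∈ nbr D (p j).H → x ∈ (p j).M) → ∃ i, (p i).z = some x := by
    intro x hxz b hb hp
    by_contra hno
    push Not at hno
    have h1 : ∀ i, b < i → x ∈ pend D Z p i := fun i hi =>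
      ⟨hxz, ⟨b, hi, hb, hp b hb⟩, fun j _ hj => hp j hj, fun j _ => hno j⟩
    have h2 : ∀ i : Set.Ioi b, ∃ y, (p i).z = some y ∧ y ∈ (p b).M := by
      rintro ⟨i, hi⟩
      rcases hzi : (p i).z with _ | y
      · have := h1 i hi
        rw [hnone i hzi] at this
        exact absurd this (by simp)
      · exact ⟨y, rfl, (hsome i y hzi).2 x (h1 i hi) b hi (hp b hb)⟩
    choose y hy hyM using h2
    have hinj : Function.Injective fun i => (⟨y i, hyM i⟩ : (p b).M) := by
      intro i j hij
      have hyy : y i = y j := congrArg Subtype.val hij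
      rcases lt_trichotomy i.1 j.1 with hlt | heq | hlt
      · exact absurd (hy i) (hyy ▸ (hsome _ _ (hy j)).1.2.2.2 _ hlt)
      · exact Subtype.ext heq
      · exact absurd (hy j) (hyy ▸ (hsome _ _ (hy i)).1.2.2.2 _ hlt)
    exact absurd (mk_le_of_injective hinj) (not_le.2 (hcard b))
  -- the assignment of indices
  have hidx : ∀ v, ∃ i, v ∈ nbr D (⋃ i, (p i).H) → v ∉ Z → v ∈ nbr D (p i).H ∧
      ((p i).z = some v ∨ (v ∉ (p i).M ∧ (∀ j, (p j).z ≠ some v) ∧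
        (∀ j, IsGreatest {j | v ∉ (p j).M} j → v ∈ nbr D (p j).H → i = j) ∧
        (IsGreatest {j | v ∉ (p j).M} i ∨ ∀ j, v ∈ nbr D (p j).H → v ∉ (p j).M → i ≤ j))) := by
    intro v
    by_cases hv : v ∈ nbr D (⋃ i, (p i).H)
    swap
    · exact ⟨Classical.arbitrary I, fun h => absurd h hv⟩
    by_cases hz : v ∈ Z
    · exact ⟨Classical.arbitrary I, fun _ h => absurd hz h⟩
    by_cases hpz : ∃ i, (p i).z = some v
    · obtain ⟨i, hi⟩ := hpz
      exact ⟨i, fun _ _ => ⟨((hV i).z_mem v hi).2.1, Or.inl hi⟩⟩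
    by_cases hg : ∃ i, IsGreatest {j | v ∉ (p j).M} i ∧ v ∈ nbr D (p i).H
    · obtain ⟨i, hi, hin⟩ := hg
      push Not at hpz
      exact ⟨i, fun _ _ => ⟨hin, Or.inr ⟨hi.1, hpz, fun j hj _ => hi.unique hj, Or.inl hi⟩⟩⟩
    · have hne : {j | v ∈ nbr D (p j).H ∧ v ∉ (p j).M}.Nonempty := by
        by_contra hemp
        rw [nbr_iUnion, Set.mem_iUnion] at hv
        obtain ⟨b, hb⟩ := hv
        refine hpz (hz_of_pend v hz b hb fun j hj => ?_)
        by_contra hjM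
        exact hemp ⟨j, hj, hjM⟩
      obtain ⟨i, ⟨h1, h2⟩, hmin⟩ := WellFounded.has_min wellFounded_lt _ hne
      push Not at hpz hg
      exact ⟨i, fun _ _ => ⟨h1, Or.inr ⟨h2, hpz, fun j hj hjn => absurd hjn (hg j hj),
        Or.inr fun j h3 h4 => not_lt.1 (hmin j ⟨h3, h4⟩)⟩⟩⟩
  choose ζ hζ using hidx
  set H := ⋃ i, (p i).H with hH
  have hsubH : ∀ i, (p i).H ⊆ H := fun i => Set.subset_iUnion (fun i => (p i).H) i
  have hnot : ∀ v ∈ nbr D H, v ∉ Z → v ∉ (Z ∪ (p (ζ v)).M) \ {x | (p (ζ v)).z = some x} := by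
    rintro v hv hz ⟨h1 | h1, h2⟩
    · exact hz h1
    · rcases (hζ v hv hz).2 with h3 | h3
      exacts [h2 h3, h3.1 h1]
  have hmaps : ∀ v ∈ nbr D H, v ∉ Z → (p (ζ v)).f' v ∈ (p (ζ v)).H := fun v hv hz =>
    (hV _).wave'.maps v (hζ v hv hz).1 (hnot v hv hz)
  have hadj : ∀ v ∈ nbr D H, v ∉ Z → Adj D ((p (ζ v)).f' v) v := fun v hv hz =>
    (hV _).wave'.adj v (hζ v hv hz).1 (hnot v hv hz)
  have hle : ∀ v ∈ nbr D H, v ∉ Z → ∀ k, k ≤ ζ v → (p (ζ v)).f' v ∉ (p k).M :=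
    fun v hv hz k hk hm => hHM _ _ (hmaps v hv hz) (hmono _ _ hk hm)
  have hgt : ∀ v ∈ nbr D H, v ∉ Z → ∀ k, ζ v < k → ((p (ζ v)).f' v ∈ (p k).M ↔ v ∈ (p k).M) :=
    fun v hv hz k hk => (hV _).mem_iff (hC k _ hk) (hζ v hv hz).1 hz
  have hlam : ∀ v ∈ nbr D H, v ∉ Z → (∀ j, (p j).z ≠ some v) →
      {j | (p (ζ v)).f' v ∉ (p j).M} = {j | v ∉ (p j).M} := by
    intro v hv hz hnz
    ext k
    rw [Set.mem_ofPred_eq, Set.mem_ofPred_eq, not_iff_not]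
    rcases le_or_gt k (ζ v) with hk | hk
    · have h1 := hle v hv hz k hk
      have h2 := ((hζ v hv hz).2.resolve_left (hnz _)).1
      exact ⟨fun h => absurd h h1, fun h => absurd (hmono _ _ hk h) h2⟩
    · exact hgt v hv hz k hk
  have hlamz : ∀ v ∈ nbr D H, v ∉ Z → (p (ζ v)).z = some v →
      IsGreatest {j | (p (ζ v)).f' v ∉ (p j).M} (ζ v) := by
    intro v hv hz hvz
    refine ⟨hle v hv hz _ le_rfl, fun k hk => ?_⟩
    by_contra hlt
    rw [not_le] at hlt
    exact hk ((hgt v hv hz k hlt).2 (hmono _ _ hlt.le ((hV _).z_mem v hvz).1))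
  have hzcase : ∀ v ∈ nbr D H, v ∉ Z → (p (ζ v)).z = some v ∨ ∀ j, (p j).z ≠ some v :=
    fun v hv hz => (hζ v hv hz).2.imp id fun h => h.2.1
  refine ⟨H, fun v => (p (ζ v)).f' v, ⟨?_, ?_, hadj, ?_, ?_⟩, ?_⟩
  · intro v hv hy
    obtain ⟨i, hi⟩ := Set.mem_iUnion.1 hv
    exact (hV i).wave.disj v hi (Or.inl hy)
  · exact fun v hv hz => hsubH _ (hmaps v hv hz)
  · have aux : ∀ v ∈ nbr D H, v ∉ Z → ∀ v' ∈ nbr D H, v' ∉ Z →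
        (p (ζ v)).f' v = (p (ζ v')).f' v' → ¬ ζ v < ζ v' := by
      intro v hv hz v' hv' hz' he hlt
      have h1 : v' ∈ nbr D (p (ζ v)).H := ⟨_, hmaps v hv hz, he ▸ hadj v' hv' hz'⟩
      have h2 : v ∈ nbr D (p (ζ v')).H := ⟨_, hmaps v' hv' hz', he ▸ hadj v hv hz⟩
      have hmax : IsGreatest {j | (p (ζ v')).f' v' ∉ (p j).M} (ζ v') := by
        rcases hzcase v' hv' hz' with h3 | h3
        · exact hlamz v' hv' hz' h3
        · rw [hlam v' hv' hz' h3]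
          obtain ⟨h4, -, -, h5⟩ := (hζ v' hv' hz').2.resolve_left (h3 _)
          refine h5.resolve_right fun h6 => ?_
          exact absurd (h6 _ h1 fun h7 => h4 (hmono _ _ hlt.le h7)) (not_le.2 hlt)
      rw [← he] at hmax
      rcases hzcase v hv hz with h3 | h3
      · exact hlt.ne ((hlamz v hv hz h3).unique hmax)
      · rw [hlam v hv hz h3] at hmax
        exact hlt.ne (((hζ v hv hz).2.resolve_left (h3 _)).2.2.1 _ hmax h2)
    intro v hv hz v' hv' hz' he
    have e : ζ v = ζ v' := le_antisymm (not_lt.1 (aux v' hv' hz' v hv hz he.symm))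
      (not_lt.1 (aux v hv hz v' hv' hz' he))
    refine (hV (ζ v)).wave'.inj v (hζ v hv hz).1 (hnot v hv hz) v' ?_ ?_ ?_
    · rw [e]
      exact (hζ v' hv' hz').1
    · rw [e]
      exact hnot v' hv' hz'
    · rw [he, e]
  · intro g hg hr
    have hgH : ∀ n, g (n + 1) ∈ (p (ζ (g n))).H := fun n => by
      rw [(hr n).2.2]
      exact hmaps _ (hr n).1 (hr n).2.1
    have hnz : ∀ n j, (p j).z ≠ some (g (n + 1)) := fun n j hj =>
      hHM _ _ (hgH n) (hpend_of_z j _ hj _ (subset_nbr D _ (hgH n)))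
    have hconst : ∀ n, {j | g (n + 1) ∉ (p j).M} = {j | g 1 ∉ (p j).M} := by
      intro n
      induction n with
      | zero => rfl
      | succ n ih => rw [← ih, (hr (n + 1)).2.2, hlam _ (hr _).1 (hr _).2.1 (hnz n)]
    have hspec : ∀ n, _ := fun n =>
      (hζ _ (hr (n + 1)).1 (hr (n + 1)).2.1).2.resolve_left (hnz n _)
    suffices h : ∃ N, ∀ n, N ≤ n → ζ (g (n + 1)) = ζ (g (N + 1)) by
      obtain ⟨N, hN⟩ := h
      refine (hV (ζ (g (N + 1)))).wave'.noRay_tail hg (N + 1) fun n hn => ?_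
      obtain ⟨m, rfl⟩ : ∃ m, n = m + 1 := ⟨n - 1, by omega⟩
      have e := hN m (by omega)
      have h1 := (hζ _ (hr (m + 1)).1 (hr (m + 1)).2.1).1
      have h2 := hnot _ (hr (m + 1)).1 (hr (m + 1)).2.1
      rw [e] at h1 h2
      refine ⟨h1, h2, ?_⟩
      rw [(hr (m + 1)).2.2, e]
    by_cases hc : ∃ i, IsGreatest {j | g 1 ∉ (p j).M} i ∧ ∃ n, g (n + 1) ∈ nbr D (p i).H
    · obtain ⟨i, hi, n, hn⟩ := hc
      have hN : ∀ m, n ≤ m → g (m + 1) ∈ nbr D (p i).H ∧ ζ (g (m + 1)) = i := by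
        intro m hm
        induction m, hm using Nat.le_induction with
        | base => exact ⟨hn, (hspec n).2.2.1 i (by rwa [hconst]) hn⟩
        | succ m _ ih =>
          have h1 := subset_nbr D _ (hgH (m + 1))
          rw [ih.2] at h1
          exact ⟨h1, (hspec _).2.2.1 i (by rwa [hconst]) h1⟩
      exact ⟨n, fun m hm => by rw [(hN m hm).2, (hN n le_rfl).2]⟩
    · refine nat_antitone_eventually_const (fun n => ζ (g (n + 1))) fun n => ?_
      refine ((hspec (n + 1)).2.2.2.resolve_left fun h1 => hc ⟨_, by rwa [hconst] at h1, n + 1,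
        (hζ _ (hr _).1 (hr _).2.1).1⟩) _ (subset_nbr D _ (hgH _)) (hHM _ _ (hgH _))
  · obtain ⟨i, -, hi⟩ := WellFounded.has_min (wellFounded_lt (α := I)) Set.univ Set.univ_nonempty
    have hbot : ∀ j, i ≤ j := fun j => not_lt.1 (hi j trivial)
    have hzi : (p i).z = none := by
      rcases hzi : (p i).z with _ | x
      · rfl
      · obtain ⟨j, hj, -⟩ := (hsome i x hzi).1.2.1
        exact absurd hj (not_lt.2 (hbot j))
    refine ⟨(p i).u, hsubH i (hV i).mem, fun v hv hz he => ?_⟩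
    replace he : (p (ζ v)).f' v = (p i).u := he
    rcases (hbot (ζ v)).eq_or_lt with h1 | h1
    · obtain ⟨h2, h3⟩ := hζ v hv hz
      rw [← h1] at h2 h3 he
      have h4 := h3.resolve_left (by simp [hzi])
      exact (hV i).spare hzi v h2 hz h4.1 he
    · exact hHM _ _ (hmaps v hv hz) (he ▸ (hC _ i h1).mem)

theorem mk_union_lt {κ : Cardinal.{u}} (hκ : ℵ₀ ≤ κ) {S T : Set V} (hS : #S < κ) (hT : #T < κ) :
    #(S ∪ T : Set V) < κ :=
  (mk_union_le S T).trans_lt (add_lt_of_lt hκ hS hT)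

theorem mk_lt_of_finite {κ : Cardinal.{u}} (hκ : ℵ₀ ≤ κ) {S : Set V} (hS : S.Finite) : #S < κ :=
  (lt_aleph0_iff_set_finite.2 hS).trans_le hκ

/-- A well-order of type `κ.ord`. -/
theorem exists_wellOrder (κ : Cardinal.{u}) (hκ : ℵ₀ ≤ κ) : ∃ (I : Type u) (_ : LinearOrder I),
    WellFoundedLT I ∧ Nonempty I ∧ #I = κ ∧ (∀ i : I, #(Set.Iio i) < κ) ∧
    ∀ i : I, #(Set.Ioi i) = κ := by
  have hI : #κ.ord.ToType = κ := by simp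
  have hlt : ∀ i : κ.ord.ToType, #(Set.Iio i) < κ := fun i => by simpa using mk_Iio_lt i
  refine ⟨κ.ord.ToType, inferInstance, inferInstance, ?_, hI, hlt, fun i => ?_⟩
  · rw [← mk_ne_zero_iff, hI]
    exact (aleph0_pos.trans_le hκ).ne'
  · refine le_antisymm ((mk_set_le _).trans hI.le) (not_lt.1 fun h => ?_)
    have h1 : (Set.univ : Set κ.ord.ToType) = (Set.Iio i ∪ {i}) ∪ Set.Ioi i := by
      ext j
      simp
    have h2 := mk_union_lt hκ (mk_union_lt hκ (hlt i) (mk_lt_of_finite hκ (Set.finite_singleton i))) h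
    rw [← h1, mk_univ, hI] at h2
    exact h2.false

/-- The set of vertices forced into a set containing `e` and closed with respect to `p`. -/
def Piece.closure (D : V → V → Prop) (Z : Set V) (p : Piece V) (e : Finset V) : Set V :=
  ((p.M ∪ ({p.u} ∪ p.T)) ∪ p.f '' e) ∪
    {v | v ∈ nbr D p.H ∧ v ∉ Z ∧ v ∉ p.M ∧ p.f v ∈ e}

theorem Piece.closes_of_closure_subset {p : Piece V} {M : Set V}
    (h : ∀ e : Finset V, ↑e ⊆ M → p.closure D Z e ⊆ M) : p.Closes D Z M where
  subset v hv := h ∅ (by simp) (Or.inl (Or.inl (Or.inl hv)))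
  mem := h ∅ (by simp) (Or.inl (Or.inl (Or.inr (Or.inl rfl))))
  T_subset v hv := h ∅ (by simp) (Or.inl (Or.inl (Or.inr (Or.inr hv))))
  maps v hv := h {v} (by simpa using hv) (Or.inl (Or.inr ⟨v, by simp, rfl⟩))
  preimage v hv hz hM hf := h {p.f v} (by simpa using hf) (Or.inr ⟨hv, hz, hM, by simp⟩)

theorem Piece.Valid.mk_closure_lt {κ : Cardinal.{u}} (hκ : ℵ₀ ≤ κ) {p : Piece V}
    (hp : p.Valid D Y Z) (hM : #p.M < κ) (e : Finset V) : #(p.closure D Z e) < κ := by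
  refine mk_union_lt hκ (mk_union_lt hκ (mk_union_lt hκ hM (mk_lt_of_finite hκ
    ((Set.finite_singleton _).union hp.finite))) (mk_lt_of_finite hκ (e.finite_toSet.image _)))
    (mk_lt_of_finite hκ (e.finite_toSet.of_injOn (f := p.f) (fun v hv => hv.2.2.2) ?_))
  intro v hv w hw he
  exact hp.wave.inj v hv.1 (by simp [hv.2.1, hv.2.2.1]) w hw.1 (by simp [hw.2.1, hw.2.2.1]) he

/-- A small set `M` whose deletion leaves the web hindered by a reduced wave. -/
structure IsBad (D : V → V → Prop) (Y Z : Set V) (κ : Cardinal.{u}) (φ : Finset V → Set V)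
    (M H : Set V) (f : V → V) (u : V) : Prop where
  card : #M < κ
  closed : ∀ e : Finset V, ↑e ⊆ M → φ e ⊆ M
  wave : IsWave D (Y ∪ M) (Z ∪ M) H f
  mem : u ∈ H
  spare : ∀ v ∈ nbr D H, v ∉ Z ∪ M → f v ≠ u
  reach : ∀ w ∈ H, Reach D (Z ∪ M) f {u} w

theorem IsBad.mono {κ : Cardinal.{u}} {φ φ' : Finset V → Set V} {M H : Set V} {f : V → V} {u : V}
    (h : IsBad D Y Z κ φ M H f u) (hφ : ∀ e, φ' e ⊆ φ e) : IsBad D Y Z κ φ' M H f u :=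
  ⟨h.card, fun e he => (hφ e).trans (h.closed e he), h.wave, h.mem, h.spare, h.reach⟩

theorem Hindered.exists_isBad {κ : Cardinal.{u}} {φ : Finset V → Set V} {M : Set V}
    (h : Hindered D (Y ∪ M) (Z ∪ M)) (hM : #M < κ) (hφ : ∀ e : Finset V, ↑e ⊆ M → φ e ⊆ M) :
    ∃ H f u, IsBad D Y Z κ φ M H f u := by
  obtain ⟨R, f, hw, u, hu, hs⟩ := h
  have hE : {u} ⊆ R := by simpa using hu
  have hsub : {w | Reach D (Z ∪ M) f {u} w} ⊆ R := fun w hh => Reach.mem hw hE hh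
  exact ⟨_, f, u, hM, hφ, hw.reach hE, Reach.base u rfl, fun v hv => hs v (nbr_mono D hsub hv),
    fun w hw => hw⟩

/-- If the web is unhindered, then so are most of the webs obtained by deleting few vertices. -/
theorem exists_closure_unhindered {κ : Cardinal.{u}} (hκ : ℵ₀ < κ) (hreg : κ.IsRegular)
    (hun : ¬ Hindered D Y Z) : ∃ φ : Finset V → Set V, (∀ e, #(φ e) < κ) ∧
      ∀ M : Set V, #M < κ → (∀ e : Finset V, ↑e ⊆ M → φ e ⊆ M) →
        ¬ Hindered D (Y ∪ M) (Z ∪ M) := by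
  classical
  by_contra hc
  push Not at hc
  have hbad : ∀ φ : Finset V → Set V, (∀ e, #(φ e) < κ) → ∃ M H f u, IsBad D Y Z κ φ M H f u := by
    intro φ hφ
    obtain ⟨M, hM, hcl, hh⟩ := hc φ hφ
    exact ⟨M, hh.exists_isBad hM hcl⟩
  have hunion : ∀ {ι : Type u} (t : ι → Set V), #ι < κ → (∀ i, #(t i) < κ) → #(⋃ i, t i) < κ :=
    fun t hι ht => (card_iUnion_lt_iff_forall_of_isRegular hreg hι).2 ht
  let Pop : V → Prop := fun z => ∀ φ : Finset V → Set V, (∀ e, #(φ e) < κ) →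
    ∃ M H f u, IsBad D Y Z κ φ M H f u ∧ z ∈ M ∧ z ∈ nbr D H
  have hnp : ∀ z, ∃ φ : Finset V → Set V, (∀ e, #(φ e) < κ) ∧
      (¬ Pop z → ∀ M H f u, IsBad D Y Z κ φ M H f u → z ∈ M → z ∉ nbr D H) := by
    intro z
    by_cases hz : Pop z
    · exact ⟨fun _ => ∅, fun e => mk_lt_of_finite hκ.le Set.finite_empty, fun h => absurd hz h⟩
    · have hz' := hz
      simp only [Pop] at hz'
      push Not at hz'
      obtain ⟨φ, h1, h2⟩ := hz'
      exact ⟨φ, h1, fun _ M H f u hb => h2 M H f u hb⟩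
  choose φz hφz hφz' using hnp
  let φs : Finset V → Set V := fun e => ⋃ p : {p : V × Finset V // p.1 ∈ e ∧ p.2 ⊆ e},
    φz p.1.1 p.1.2
  have hφs : ∀ e, #(φs e) < κ := by
    intro e
    refine hunion _ (lt_of_lt_of_le ?_ hκ.le) fun p => hφz _ _
    refine lt_aleph0_iff_finite.2 (Set.Finite.subset (e ×ˢ e.powerset).finite_toSet ?_)
    rintro ⟨z, e'⟩ ⟨h1, h2⟩
    simpa using ⟨h1, h2⟩
  have hpop : ∀ M H f u, IsBad D Y Z κ φs M H f u → ∀ z ∈ M, z ∈ nbr D H → Pop z := by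
    intro M H f u hb z hz hzn
    by_contra hnp
    refine hφz' z hnp M H f u ⟨hb.card, fun e he => ?_, hb.wave, hb.mem, hb.spare, hb.reach⟩ hz hzn
    refine subset_trans ?_ (hb.closed (insert z e) (by simp [Set.insert_subset_iff, hz, he]))
    exact Set.subset_iUnion (fun p : {p : V × Finset V // p.1 ∈ insert z e ∧ p.2 ⊆ insert z e} =>
      φz p.1.1 p.1.2) ⟨(z, e), by simp⟩
  obtain ⟨I, _, _, hne, hI, hIio, hIoi⟩ := exists_wellOrder κ hκ.le
  obtain ⟨M₀, H₀, f₀, u₀, -⟩ := hbad φs hφs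
  have : Nonempty (Piece V) := ⟨⟨M₀, H₀, ∅, none, u₀, f₀, f₀⟩⟩
  let P : I → (I → Piece V) → Piece V → Prop := fun i g a =>
    a.Valid D Y Z ∧ IsBad D Y Z κ φs a.M a.H a.f a.u ∧
    (∀ j < i, (g j).Closes D Z a.M) ∧ (a.z = none → pend D Z g i = ∅) ∧
    (∀ x, a.z = some x → x ∈ pend D Z g i ∧
      ∀ y ∈ pend D Z g i, ∀ j < i, y ∈ (g j).M → x ∈ (g j).M)
  suffices h : ∃ p, ∀ i, P i p (p i) by
    obtain ⟨p, hp⟩ := h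
    refine hun (hindered_of_pieces p (fun i => (hp i).1) (fun i => (hp i).2.2.1) (fun i => ?_)
      (fun i => (hp i).2.2.2.1) (fun i => (hp i).2.2.2.2))
    rw [hIoi]
    exact (hp i).2.1.card
  refine exists_of_wellFoundedLT P ?_ ?_
  · rintro i g g' a hg ⟨h1, h2, h3, h4, h5⟩
    have hpe : pend D Z g' i = pend D Z g i := by
      ext x
      simp only [pend, Set.mem_ofPred_eq]
      refine and_congr_right fun _ => and_congr ?_ (and_congr ?_ ?_)
      · exact exists_congr fun j => and_congr_right fun hj => by rw [hg j hj]
      · exact forall_congr' fun j => forall_congr' fun hj => by rw [hg j hj]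
      · exact forall_congr' fun j => forall_congr' fun hj => by rw [hg j hj]
    simp only [P, hpe]
    refine ⟨h1, h2, fun j hj => hg j hj ▸ h3 j hj, h4, fun x hx => ⟨(h5 x hx).1, ?_⟩⟩
    intro y hy j hj
    rw [← hg j hj]
    exact (h5 x hx).2 y hy j hj
  · intro i g hg
    let φi : Finset V → Set V := fun e => φs e ∪ ⋃ j : Set.Iio i, (g j).closure D Z e
    have hφi : ∀ e, #(φi e) < κ := fun e => mk_union_lt hκ.le (hφs e)
      (hunion _ (hIio i) fun j => (hg j j.2).1.mk_closure_lt hκ.le (hg j j.2).2.1.card e)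
    have hcl : ∀ M H f u, IsBad D Y Z κ φi M H f u → ∀ j < i, (g j).Closes D Z M := by
      intro M H f u hb j hj
      refine Piece.closes_of_closure_subset fun e he => subset_trans ?_ (hb.closed e he)
      exact (Set.subset_iUnion (fun j : Set.Iio i => (g j).closure D Z e) ⟨j, hj⟩).trans
        Set.subset_union_right
    have hsub : ∀ e, φs e ⊆ φi e := fun e => Set.subset_union_left
    by_cases hpe : pend D Z g i = ∅
    · obtain ⟨M, H, f, u, hb⟩ := hbad φi hφi
      refine ⟨⟨M, H, ∅, none, u, f, f⟩, ⟨hb.wave, by simpa using hb.wave, hb.mem, ?_, by simp,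
        Set.finite_empty, by simp, by simp⟩, hb.mono hsub, hcl M H f u hb, fun _ => hpe, by simp⟩
      intro _ v hv hz hM
      exact hb.spare v hv (by simp [hz, hM])
    · rw [← ne_eq, ← Set.nonempty_iff_ne_empty] at hpe
      have hne' : {j | j < i ∧ ∃ x ∈ pend D Z g i, x ∈ (g j).M}.Nonempty := by
        obtain ⟨x, hx⟩ := hpe
        obtain ⟨j, hj, -, hjM⟩ := hx.2.1
        exact ⟨j, hj, x, hx, hjM⟩
      obtain ⟨j₀, ⟨hj₀, x, hx, hxM⟩, hmin⟩ := WellFounded.has_min wellFounded_lt _ hne'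
      have hxpop : Pop x := by
        obtain ⟨j, hj, hjn, hjM⟩ := hx.2.1
        exact hpop _ _ _ _ (hg j hj).2.1 x hjM hjn
      obtain ⟨M, H, f, u, hb, hxm, hxn⟩ := hxpop φi hφi
      have hxn' : x ∈ nbr D {w | Reach D (Z ∪ M) f {u} w} := nbr_mono D (fun w hw => hb.reach w hw) hxn
      obtain ⟨T, f', h1, h2, h3, h4, h5⟩ := hb.wave.augment hb.mem hb.spare (Or.inr hxm) hxn'
      refine ⟨⟨M, H, T, some x, u, f, f'⟩, ⟨hb.wave, ?_, hb.mem, by simp, ?_, h1, ?_, ?_⟩,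
        hb.mono hsub, hcl M H f u hb, by simp, ?_⟩
      · simpa [eq_comm] using h3
      · rintro y hy
        obtain rfl : x = y := by simpa using hy
        exact ⟨hxm, hxn, hx.1⟩
      · intro v hv hv'
        exact h4 v hv fun h => hv' (by rw [h])
      · intro v hv
        exact h5 v (hv.imp id fun h => by simpa [eq_comm] using h)
      · rintro y hy
        obtain rfl : x = y := by simpa using hy
        refine ⟨hx, fun y hy j hj hyj => ?_⟩
        have hle : j₀ ≤ j := not_lt.1 (hmin j ⟨hj, y, hy, hyj⟩)
        rcases hle.eq_or_lt with rfl | hlt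
        · exact hxM
        · exact ((hg j hj).2.2.1 j₀ hlt).subset hxM

/-- The vertices not available for extending `S` after deleting `S` and taking the quotient by
the largest wave. -/
def blocked (D : V → V → Prop) (Y Z S : Set V) : Set V :=
  Z ∪ S ∪ nbr D (waveMax D (Y ∪ S) (Z ∪ S))

/-- Reachability by walks all of whose vertices but the first one are in `S`. -/
def Conn (D : V → V → Prop) (S : Set V) : V → V → Prop :=
  Relation.ReflTransGen fun x y => D x y ∧ y ∈ S

/-- A connected set with root `a` all of whose finite parts can be deleted safely. -/
structure IsSafe (D : V → V → Prop) (Y Z : Set V) (a : V) (S : Set V) : Prop where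
  mem : a ∈ S
  eq_root : ∀ s ∈ S, s ∈ Z → s = a
  conn : ∀ s ∈ S, Conn D S a s
  safe : ∀ T ⊆ S, T.Finite → ∃ Q ⊆ S, Q.Finite ∧ T ⊆ Q ∧ ¬ Hindered D (Y ∪ Q) (Z ∪ Q)

/-- `S'` extends `S` by unblocked vertices. -/
def Extends (D : V → V → Prop) (Y Z S S' : Set V) : Prop :=
  S ⊆ S' ∧ ∀ v ∈ S', v ∉ S → v ∉ blocked D Y Z S

/-- All successors of `s` are blocked. -/
def IsDead (D : V → V → Prop) (Y Z S : Set V) (s : V) : Prop :=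
  ∀ v, Adj D s v → v ∈ blocked D Y Z S

/-- The vertices which belong to a wave up to finitely many uncovered vertices. -/
def nearWave (D : V → V → Prop) (Y Z : Set V) : Set V :=
  {v | ∃ Q : Set V, Q.Finite ∧ ∃ H f, IsWave D Y (Z ∪ Q) H f ∧ v ∈ H}

/-- The elements of `S` which are neither dead nor free. -/
def bound (D : V → V → Prop) (Y Z S : Set V) : Set V :=
  {s | s ∈ S ∧ ¬ IsDead D Y Z S s ∧ s ∈ nearWave D Y Z}

theorem Conn.mono {S S' : Set V} (h : S ⊆ S') {x y : V} (hxy : Conn D S x y) : Conn D S' x y :=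
  Relation.ReflTransGen.mono (fun _ _ hh => ⟨hh.1, h hh.2⟩) _ _ hxy

theorem Conn.exists_finite {S : Set V} {x y : V} (hxy : Conn D S x y) :
    ∃ T ⊆ S, T.Finite ∧ Conn D T x y := by
  induction hxy with
  | refl => exact ⟨∅, by simp, by simp, Relation.ReflTransGen.refl⟩
  | tail _ h ih =>
    obtain ⟨T, h1, h2, h3⟩ := ih
    exact ⟨insert _ T, Set.insert_subset h.2 h1, h2.insert _,
      (h3.mono (Set.subset_insert _ _)).tail ⟨h.1, Set.mem_insert _ _⟩⟩

theorem Conn.tail_adj {S : Set V} {x y z : V} (hxy : Conn D S x y) (h : Adj D y z) (hz : z ∈ S) :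
    Conn D S x z := by
  rcases h with rfl | h
  exacts [hxy, hxy.tail ⟨h, hz⟩]

theorem subset_blocked {S : Set V} : S ⊆ blocked D Y Z S := fun _ h => Or.inl (Or.inr h)

theorem waveMax_subset_blocked {S : Set V} :
    waveMax D (Y ∪ S) (Z ∪ S) ⊆ blocked D Y Z S := fun _ h => Or.inr (subset_nbr D _ h)

theorem Extends.waveMax_subset {S S' : Set V} (h : Extends D Y Z S S') :
    waveMax D (Y ∪ S) (Z ∪ S) ⊆ waveMax D (Y ∪ S') (Z ∪ S') := by
  obtain ⟨f, hf⟩ := exists_isWave_waveMax D (Y ∪ S) (Z ∪ S)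
  refine (hf.mono (Y' := Y ∪ S') (Z' := Z ∪ S') ?_
    (Set.union_subset_union_right _ h.1)).subset_waveMax
  rintro u hu (hu' | hu')
  · exact hf.disj u hu (Or.inl hu')
  · exact h.2 u hu' (fun hh => hf.disj u hu (Or.inr hh)) (waveMax_subset_blocked hu)

theorem Extends.blocked_subset {S S' : Set V} (h : Extends D Y Z S S') :
    blocked D Y Z S ⊆ blocked D Y Z S' :=
  Set.union_subset_union (Set.union_subset_union_right _ h.1) (nbr_mono D h.waveMax_subset)

theorem Extends.refl (S : Set V) : Extends D Y Z S S := ⟨subset_rfl, fun _ h h' => absurd h h'⟩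

theorem Extends.trans {S S' S'' : Set V} (h : Extends D Y Z S S') (h' : Extends D Y Z S' S'') :
    Extends D Y Z S S'' := by
  refine ⟨h.1.trans h'.1, fun v hv hvS hb => ?_⟩
  by_cases hv' : v ∈ S'
  exacts [h.2 v hv' hvS hb, h'.2 v hv hv' (h.blocked_subset hb)]

theorem Extends.isDead {S S' : Set V} (h : Extends D Y Z S S') {s : V} (hs : IsDead D Y Z S s) :
    IsDead D Y Z S' s := fun v hv => h.blocked_subset (hs v hv)

theorem IsSafe.sUnion {a : V} {c : Set (Set V)} (hc : ∀ S ∈ c, IsSafe D Y Z a S) (hne : c.Nonempty)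
    (hdir : ∀ S ∈ c, ∀ S' ∈ c, Extends D Y Z S S' ∨ Extends D Y Z S' S) :
    IsSafe D Y Z a (⋃₀ c) ∧ ∀ S ∈ c, Extends D Y Z S (⋃₀ c) := by
  refine ⟨⟨?_, ?_, ?_, ?_⟩, fun S hS => ⟨Set.subset_sUnion_of_mem hS, ?_⟩⟩
  · obtain ⟨S, hS⟩ := hne
    exact ⟨S, hS, (hc S hS).mem⟩
  · rintro s ⟨S, hS, hs⟩
    exact (hc S hS).eq_root s hs
  · rintro s ⟨S, hS, hs⟩
    exact ((hc S hS).conn s hs).mono (Set.subset_sUnion_of_mem hS)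
  · intro T hT hfin
    obtain ⟨S, hS, hTS⟩ := DirectedOn.exists_mem_subset_of_finite_of_subset_sUnion hne
      (fun S hS S' hS' => (hdir S hS S' hS').elim (fun h => ⟨S', hS', h.1, subset_rfl⟩)
        fun h => ⟨S, hS, subset_rfl, h.1⟩) hfin hT
    obtain ⟨Q, h1, h2⟩ := (hc S hS).safe T hTS hfin
    exact ⟨Q, h1.trans (Set.subset_sUnion_of_mem hS), h2⟩
  · rintro v ⟨S', hS', hv⟩ hvS
    rcases hdir S hS S' hS' with h | h
    exacts [h.2 v hv hvS, absurd (h.1 hv) hvS]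

theorem bound_sUnion {c : Set (Set V)} (hext : ∀ S ∈ c, Extends D Y Z S (⋃₀ c))
    (hb : ∀ S ∈ c, ∀ s ∈ bound D Y Z S, ∃ S' ∈ c, IsDead D Y Z S' s) :
    bound D Y Z (⋃₀ c) = ∅ := by
  rw [Set.eq_empty_iff_forall_notMem]
  rintro s ⟨⟨S, hS, hs⟩, hnd, hn⟩
  obtain ⟨S', hS', hd⟩ := hb S hS s ⟨hs, fun hd => hnd ((hext S hS).isDead hd), hn⟩
  exact hnd ((hext S' hS').isDead hd)

/-- The forward chains of `f` starting in `F`. -/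
inductive Forward (D : V → V → Prop) (Z R F : Set V) (f : V → V) : V → Prop
  | base (y : V) : y ∈ F → Forward D Z R F f y
  | step (v : V) : v ∈ nbr D R → v ∉ Z → v ∉ F → Forward D Z R F f (f v) → Forward D Z R F f v

/-- In an unhindered web, forward chains are finite. -/
theorem finite_forward {F : Set V} (hF : F.Finite) (h : IsWave D Y (Z ∪ F) R f)
    (hun : ¬ Hindered D Y (Z ∪ F)) : {v | Forward D Z R F f v}.Finite := by
  classical
  have hnx : ∀ u, ∃ v, ((∃ w ∈ nbr D R, w ∉ Z ∪ F ∧ f w = u) →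
      v ∈ nbr D R ∧ v ∉ Z ∪ F ∧ f v = u) ∧ ((¬ ∃ w ∈ nbr D R, w ∉ Z ∪ F ∧ f w = u) → v = u) := by
    intro u
    by_cases hu : ∃ w ∈ nbr D R, w ∉ Z ∪ F ∧ f w = u
    · obtain ⟨w, hw⟩ := hu
      exact ⟨w, fun _ => hw, fun hh => absurd ⟨w, hw⟩ hh⟩
    · exact ⟨u, fun hh => absurd hh hu, fun _ => rfl⟩
  choose nx hnx using hnx
  have hsub : {v | Forward D Z R F f v} ⊆ ⋃ y ∈ F, Set.range fun n => nx^[n] y := by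
    intro v hv
    simp only [Set.mem_iUnion, Set.mem_range]
    induction hv with
    | base y hy => exact ⟨y, hy, 0, rfl⟩
    | step v hv hz hvF _ ih =>
      obtain ⟨y, hy, n, hn⟩ := ih
      refine ⟨y, hy, n + 1, ?_⟩
      have hvZ : v ∉ Z ∪ F := by simp [hz, hvF]
      have h1 := (hnx (f v)).1 ⟨v, hv, hvZ, rfl⟩
      rw [Function.iterate_succ_apply', hn]
      exact h.inj _ h1.1 h1.2.1 v hv hvZ h1.2.2
  refine Set.Finite.subset (hF.biUnion fun y hy => ?_) hsub
  set c : ℕ → V := fun n => nx^[n] y with hcdef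
  have hc1 : ∀ n, c (n + 1) = nx (c n) := fun n => Function.iterate_succ_apply' nx n y
  by_cases hall : ∀ n, c (n + 1) ∈ nbr D R ∧ c (n + 1) ∉ Z ∪ F ∧ f (c (n + 1)) = c n
  · exfalso
    have hmemR : ∀ n, c n ∈ R := fun n => (hall n).2.2 ▸ h.maps _ (hall n).1 (hall n).2.1
    refine hun ⟨R, fun v => if ∃ n, v = c (n + 1) then v else f v,
      ⟨h.disj, ?_, ?_, ?_, ?_⟩, y, hmemR 0, ?_⟩
    · intro v hv hz
      split_ifs with hvc
      · obtain ⟨n, rfl⟩ := hvc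
        exact hmemR _
      · exact h.maps v hv hz
    · intro v hv hz
      split_ifs with hvc
      exacts [Or.inl rfl, h.adj v hv hz]
    · have aux : ∀ v w, (∃ n, v = c (n + 1)) → (¬ ∃ n, w = c (n + 1)) → w ∈ nbr D R →
          w ∉ Z ∪ F → v ≠ f w := by
        rintro v w ⟨n, rfl⟩ hw hwn hwz he
        exact hw ⟨n + 1, (h.inj _ (hall (n + 1)).1 (hall (n + 1)).2.1 w hwn hwz
          ((hall (n + 1)).2.2.trans he)).symm⟩
      intro v hv hz w hw hwz
      split_ifs with hvc hwc hwc
      · exact id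
      · exact fun he => absurd he (aux v w hvc hwc hw hwz)
      · exact fun he => absurd he.symm (aux w v hwc hvc hv hz)
      · exact h.inj v hv hz w hw hwz
    · intro g hg hr
      by_cases hN : ∃ N n, g N = c (n + 1)
      · obtain ⟨N, hN⟩ := hN
        have := (hr N).2.2
        rw [if_pos hN] at this
        exact absurd (hg this) (by omega)
      · refine h.noRay g hg fun n => ⟨(hr n).1, (hr n).2.1, ?_⟩
        rw [(hr n).2.2, if_neg fun hh => hN ⟨n, hh⟩]
    · intro v hv hz
      dsimp only
      split_ifs with hvc
      · obtain ⟨n, rfl⟩ := hvc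
        exact fun he => (hall n).2.1 (Or.inr (he ▸ hy))
      · exact fun he => hvc ⟨0, (h.inj v hv hz _ (hall 0).1 (hall 0).2.1
          (he.trans (hall 0).2.2.symm))⟩
  · push Not at hall
    obtain ⟨n, hn⟩ := hall
    have hfix : nx (c n) = c n := (hnx (c n)).2 fun hh => by
      have := (hnx (c n)).1 hh
      rw [← hc1] at this
      exact hn this.1 this.2.1 this.2.2
    have hconst : ∀ m, n ≤ m → c m = c n := by
      intro m hm
      induction m, hm using Nat.le_induction with
      | base => rfl
      | succ m _ ih => rw [hc1, ih, hfix]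
    refine ((Set.finite_Iic n).image c).subset ?_
    rintro _ ⟨m, rfl⟩
    rcases le_total m n with h' | h'
    exacts [⟨m, h', rfl⟩, ⟨n, Set.mem_Iic.2 le_rfl, (hconst m h').symm⟩]

theorem Forward.mem_or {F : Set V} {p : V} (h : Forward D Z R F f p) :
    p ∈ F ∨ p ∈ nbr D R ∧ p ∉ Z ∧ p ∉ F ∧ Forward D Z R F f (f p) := by
  cases h with
  | base y hy => exact Or.inl hy
  | step v h1 h2 h3 h4 => exact Or.inr ⟨h1, h2, h3, h4⟩

theorem Forward.subset {F W : Set V}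
    (hW : ∀ p, Forward D Z R F f p → p ∈ F ∨ f p ∈ W → p ∈ W) {p : V}
    (h : Forward D Z R F f p) : p ∈ W := by
  induction h with
  | base y hy => exact hW y (Forward.base y hy) (Or.inl hy)
  | step v h1 h2 h3 h4 ih => exact hW v (Forward.step v h1 h2 h3 h4) (Or.inr ih)

/-- A wave avoiding initial parts of forward chains and reaching the next vertex of such a chain
can be combined to a hindrance. -/
theorem hindered_of_forward {F W K : Set V} {g : V → V} {p : V} (h : IsWave D Y (Z ∪ F) R f)
    (hWP : ∀ w ∈ W, Forward D Z R F f w) (hWf : ∀ w ∈ W, w ∉ F → f w ∈ W)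
    (hK : IsWave D (Y ∪ W) (Z ∪ W) K g) (hp : Forward D Z R F f p) (hpZ : p ∉ Z) (hpW : p ∉ W)
    (hpf : p ∈ F ∨ f p ∈ W) (hpK : p ∈ nbr D K) : Hindered D Y (Z ∪ F) := by
  classical
  have hWR : ∀ w ∈ W, w ∉ F → w ∈ nbr D R := fun w hw hF =>
    ((hWP w hw).mem_or.resolve_left hF).1
  have hKW : ∀ u ∈ K, u ∉ W := fun u hu hw => hK.disj u hu (Or.inr hw)
  have hfK : ∀ v, v ∈ nbr D R → v ∉ Z ∪ F → v ∉ nbr D K → f v ∉ K := fun v hv hz hvK hh =>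
    hvK ⟨_, hh, h.adj v hv hz⟩
  have hgK : ∀ v, v ∈ nbr D K → v ∉ Z ∪ F → v ∉ W → g v ∈ K := fun v hv hz hw =>
    hK.maps v hv fun hh => hh.elim (fun hh => hz (Or.inl hh)) hw
  have hfR : ∀ v, v ∈ nbr D (R ∪ K) → v ∉ Z ∪ F → ¬ (v ∉ W ∧ v ∈ nbr D K) → v ∈ nbr D R := by
    intro v hv hz hn
    rw [nbr_union] at hv
    rcases hv with hv | hv
    · exact hv
    · exact hWR v (by by_contra hw; exact hn ⟨hw, hv⟩) fun hF => hz (Or.inr hF)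
  have hfnK : ∀ v, v ∈ nbr D (R ∪ K) → v ∉ Z ∪ F → ¬ (v ∉ W ∧ v ∈ nbr D K) → f v ∉ K := by
    intro v hv hz hn
    by_cases hw : v ∈ W
    · exact fun hh => hKW _ hh (hWf v hw fun hF => hz (Or.inr hF))
    · exact hfK v (hfR v hv hz hn) hz fun hh => hn ⟨hw, hh⟩
  have hw : IsWave D Y (Z ∪ F) (R ∪ K) fun v => if v ∉ W ∧ v ∈ nbr D K then g v else f v := by
    refine ⟨?_, ?_, ?_, ?_, ?_⟩
    · rintro u (hu | hu)
      exacts [h.disj u hu, fun hh => hK.disj u hu (Or.inl hh)]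
    · intro v hv hz
      split_ifs with hc
      · exact Or.inr (hgK v hc.2 hz hc.1)
      · exact Or.inl (h.maps v (hfR v hv hz hc) hz)
    · intro v hv hz
      split_ifs with hc
      · exact hK.adj v hc.2 fun hh => hh.elim (fun hh => hz (Or.inl hh)) hc.1
      · exact h.adj v (hfR v hv hz hc) hz
    · intro v hv hz w hw hwz
      split_ifs with hc hc' hc'
      · exact hK.inj v hc.2 (fun hh => hh.elim (fun hh => hz (Or.inl hh)) hc.1) w hc'.2
          (fun hh => hh.elim (fun hh => hwz (Or.inl hh)) hc'.1)
      · exact fun he => absurd (he ▸ hgK v hc.2 hz hc.1) (hfnK w hw hwz hc')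
      · exact fun he => absurd (he.symm ▸ hgK w hc'.2 hwz hc'.1) (hfnK v hv hz hc)
      · exact h.inj v (hfR v hv hz hc) hz w (hfR w hw hwz hc') hwz
    · intro r hr hray
      by_cases hN : ∃ N, r N ∉ W ∧ r N ∈ nbr D K
      · obtain ⟨N, hN⟩ := hN
        have hall : ∀ n, N ≤ n → r n ∉ W ∧ r n ∈ nbr D K := by
          intro n hn
          induction n, hn using Nat.le_induction with
          | base => exact hN
          | succ n _ ih =>
            have h1 := (hray n).2.2
            rw [if_pos ih] at h1
            have h2 := hgK _ ih.2 (hray n).2.1 ih.1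
            rw [← h1] at h2
            exact ⟨hKW _ h2, subset_nbr D K h2⟩
        refine hK.noRay_tail hr N fun n hn => ⟨(hall n hn).2, ?_, ?_⟩
        · rintro (hh | hh)
          exacts [(hray n).2.1 (Or.inl hh), (hall n hn).1 hh]
        · rw [(hray n).2.2, if_pos (hall n hn)]
      · refine h.noRay r hr fun n => ⟨hfR _ (hray n).1 (hray n).2.1 fun hh => hN ⟨n, hh⟩,
          (hray n).2.1, ?_⟩
        rw [(hray n).2.2, if_neg fun hh => hN ⟨n, hh⟩]
  have hpZW : p ∉ Z ∪ W := by simp [hpZ, hpW]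
  by_cases hpF : p ∈ F
  · have hgp : g p ∈ K := hK.maps p hpK hpZW
    refine ⟨_, _, hw, g p, Or.inr hgp, ?_⟩
    intro v hv hz
    split_ifs with hc
    · intro he
      have := hK.inj v hc.2 (fun hh => hh.elim (fun hh => hz (Or.inl hh)) hc.1) p hpK hpZW he
      exact hz (Or.inr (this ▸ hpF))
    · exact fun he => hfnK v hv hz hc (he ▸ hgp)
  · have hfp := hpf.resolve_left hpF
    obtain ⟨h1, h2, h3, -⟩ := hp.mem_or.resolve_left hpF
    have hpZF : p ∉ Z ∪ F := by simp [h2, h3]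
    refine ⟨_, _, hw, f p, Or.inl (h.maps p h1 hpZF), ?_⟩
    intro v hv hz
    split_ifs with hc
    · exact fun he => hKW _ (hgK v hc.2 hz hc.1) (he ▸ hfp)
    · intro he
      have := h.inj v (hfR v hv hz hc) hz p h1 hpZF he
      exact hc (this ▸ ⟨hpW, hpK⟩)

/-- The part of a wave outside `S` and its largest wave. -/
theorem IsWave.diff_blocked {S Q W H : Set V} {g : V → V} (hQ : Q ⊆ S)
    (h : IsWave D (Y ∪ Q ∪ W) (Z ∪ Q ∪ W) H g) (hd : ∀ s ∈ H, s ∈ S → IsDead D Y Z S s) :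
    IsWave D (Y ∪ S ∪ waveMax D (Y ∪ S) (Z ∪ S) ∪ W) (blocked D Y Z S ∪ W)
      (H \ (S ∪ waveMax D (Y ∪ S) (Z ∪ S))) g := by
  refine h.diff ?_ ?_ ?_
  · rintro u hu hn ((( hh | hh) | hh) | hh)
    · exact h.disj u hu (Or.inl (Or.inl hh))
    · exact hn (Or.inl hh)
    · exact hn (Or.inr hh)
    · exact h.disj u hu (Or.inr hh)
  · refine Set.union_subset_union_left _ ?_
    exact (Set.union_subset_union_right _ hQ).trans Set.subset_union_left
  · intro v hv hz
    have ha : v ∉ Z ∪ Q ∪ W := by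
      rintro ((hh | hh) | hh)
      exacts [hz (Or.inl (Or.inl (Or.inl hh))), hz (Or.inl (subset_blocked (hQ hh))),
        hz (Or.inr hh)]
    rintro (hh | hh)
    · exact hz (Or.inl (hd _ (h.maps v hv ha) hh v (h.adj v hv ha)))
    · exact hz (Or.inl (Or.inr ⟨_, hh, h.adj v hv ha⟩))

theorem mem_nbr_diff_blocked {S H : Set V} (hd : ∀ s ∈ H, s ∈ S → IsDead D Y Z S s) {v : V}
    (hv : v ∈ nbr D H) (hb : v ∉ blocked D Y Z S) :
    v ∈ nbr D (H \ (S ∪ waveMax D (Y ∪ S) (Z ∪ S))) := by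
  obtain ⟨u, hu, ha⟩ := hv
  refine ⟨u, ⟨hu, ?_⟩, ha⟩
  rintro (hh | hh)
  exacts [hb (hd u hu hh v ha), hb (Or.inr ⟨u, hh, ha⟩)]

theorem dead_of_bound_subset {S Q H : Set V} {f : V → V} (hb : bound D Y Z S ⊆ Q) (hQ : Q.Finite)
    {Y' : Set V} (hY : Y ∪ (Q ∩ S) ⊆ Y')
    (h : IsWave D Y' (Z ∪ Q) H f) : ∀ s ∈ H, s ∈ S → IsDead D Y Z S s := by
  intro s hs hsS
  by_contra hnd
  have : s ∈ bound D Y Z S := ⟨hsS, hnd, Q, hQ, H, f,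
    h.mono (fun u hu hh => h.disj u hu (hY (Or.inl hh))) subset_rfl, hs⟩
  exact h.disj s hs (hY (Or.inr ⟨hb this, hsS⟩))

/-- Extending a safe set by forward chains through the largest wave. -/
theorem exists_extends_of_not_hindered {a : V} {S F : Set V} (hS : IsSafe D Y Z a S)
    (hb : (bound D Y Z S).Finite) (hF : F.Finite) (hFb : ∀ y ∈ F, y ∉ blocked D Y Z S)
    (hFc : ∀ y ∈ F, ∃ s ∈ S, Adj D s y)
    (hun : ¬ Hindered D (Y ∪ S ∪ waveMax D (Y ∪ S) (Z ∪ S)) (blocked D Y Z S ∪ F)) :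
    ∃ S', IsSafe D Y Z a S' ∧ Extends D Y Z S S' ∧ F ⊆ S' ∧ (bound D Y Z S').Finite ∧
      nbr D (waveMax D (Y ∪ S ∪ waveMax D (Y ∪ S) (Z ∪ S)) (blocked D Y Z S ∪ F)) ⊆
        blocked D Y Z S' := by
  obtain ⟨f, hf⟩ := exists_isWave_waveMax D (Y ∪ S ∪ waveMax D (Y ∪ S) (Z ∪ S))
    (blocked D Y Z S ∪ F)
  set R := waveMax D (Y ∪ S ∪ waveMax D (Y ∪ S) (Z ∪ S)) (blocked D Y Z S ∪ F) with hR
  set P : Set V := {v | Forward D (blocked D Y Z S) R F f v} with hP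
  have hPfin : P.Finite := finite_forward hF hf hun
  have hPb : ∀ p ∈ P, p ∉ blocked D Y Z S := fun p hp =>
    (Forward.mem_or hp).elim (fun h => hFb p h) fun h => h.2.1
  have hFP : F ⊆ P := fun y hy => Forward.base y hy
  have hext : Extends D Y Z S (S ∪ P) :=
    ⟨Set.subset_union_left, fun v hv hvS => hPb v (hv.resolve_left hvS)⟩
  have hsafe : ∀ Q ⊆ S, Q.Finite → bound D Y Z S ⊆ Q → ¬ Hindered D (Y ∪ Q) (Z ∪ Q) →
      ¬ Hindered D (Y ∪ Q ∪ P) (Z ∪ Q ∪ P) := by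
    intro Q hQS hQ hbQ hQun
    have hfam : {W | W ⊆ P ∧ (∀ w ∈ W, w ∉ F → f w ∈ W) ∧
        ¬ Hindered D (Y ∪ Q ∪ W) (Z ∪ Q ∪ W)}.Finite :=
      hPfin.finite_subsets.subset fun W hW => hW.1
    obtain ⟨W, -, hW⟩ := hfam.exists_le_maximal (a := ∅)
      ⟨Set.empty_subset _, by simp, by simpa using hQun⟩
    obtain ⟨hWP, hWf, hWun⟩ := hW.prop
    have hPW : P ⊆ W := by
      intro p hp
      refine Forward.subset (W := W) (fun p hp hpf => ?_) hp
      by_contra hpW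
      have hpb := hPb p hp
      have hpn : p ∉ Z ∪ Q ∪ W := by
        rintro ((hh | hh) | hh)
        exacts [hpb (Or.inl (Or.inl hh)), hpb (subset_blocked (hQS hh)), hpW hh]
      have hhind : Hindered D (Y ∪ Q ∪ W) (Z ∪ Q ∪ W ∪ {p}) := by
        by_contra hcon
        refine hpW (hW.le_of_ge (y := insert p W) ⟨Set.insert_subset hp hWP, ?_, ?_⟩
          (Set.subset_insert _ _) (Set.mem_insert _ _))
        · rintro w (rfl | hw) hwF
          · exact Or.inr (hpf.resolve_left hwF)
          · exact Or.inr (hWf w hw hwF)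
        · refine fun hh => hcon (hh.mono ?_ ?_)
          · exact Set.union_subset_union_right _ (Set.subset_insert _ _)
          · rw [Set.union_insert, Set.union_singleton]
      obtain ⟨H, g, hHg, hpH⟩ := exists_isWave_of_hindered_insert hWun hpn hhind
      have hd : ∀ s ∈ H, s ∈ S → IsDead D Y Z S s := by
        refine dead_of_bound_subset (Q := Q ∪ W) (hbQ.trans Set.subset_union_left)
          (hQ.union (hPfin.subset hWP)) (Y' := Y ∪ Q ∪ W) ?_ (by rwa [← Set.union_assoc])
        rw [Set.union_assoc]
        exact Set.union_subset_union_right _ Set.inter_subset_left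
      exact hun (hindered_of_forward hf hWP hWf (hHg.diff_blocked hQS hd) hp hpb hpW hpf
        (mem_nbr_diff_blocked hd hpH hpb))
    rwa [show P = W from hPW.antisymm hWP]
  refine ⟨S ∪ P, ⟨Or.inl hS.mem, ?_, ?_, ?_⟩, hext, fun y hy => Or.inr (hFP hy), ?_, ?_⟩
  · rintro s (hs | hs) hsZ
    exacts [hS.eq_root s hs hsZ, absurd (Or.inl (Or.inl hsZ)) (hPb s hs)]
  · rintro s (hs | hs)
    · exact (hS.conn s hs).mono Set.subset_union_left
    · have : s ∈ P ∧ Conn D (S ∪ P) a s := by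
        induction hs with
        | base y hy =>
          obtain ⟨s, hs, hsy⟩ := hFc y hy
          exact ⟨hFP hy, ((hS.conn s hs).mono Set.subset_union_left).tail_adj hsy
            (Or.inr (hFP hy))⟩
        | step v h1 h2 h3 h4 ih =>
          have : v ∈ P := Forward.step v h1 h2 h3 h4
          exact ⟨this, ih.2.tail_adj (hf.adj v h1 (by simp [h2, h3])) (Or.inr this)⟩
      exact this.2
  · intro T hT hTfin
    obtain ⟨Q, hQS, hQ, hTQ, hQun⟩ := hS.safe (T ∩ S ∪ bound D Y Z S)
      (Set.union_subset Set.inter_subset_right fun s hs => hs.1)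
      ((hTfin.inter_of_left _).union hb)
    refine ⟨Q ∪ P, Set.union_subset_union_left _ hQS, hQ.union hPfin, ?_, ?_⟩
    · intro t ht
      rcases hT ht with h | h
      exacts [Or.inl (hTQ (Or.inl ⟨ht, h⟩)), Or.inr h]
    · rw [← Set.union_assoc, ← Set.union_assoc]
      exact hsafe Q hQS hQ (fun s hs => hTQ (Or.inr hs)) hQun
  · refine (hb.union hPfin).subset ?_
    rintro s ⟨hs | hs, hnd, hn⟩
    exacts [Or.inl ⟨hs, fun hd => hnd (hext.isDead hd), hn⟩, Or.inr hs]
  · have hfP : ∀ v ∈ nbr D R, v ∉ blocked D Y Z S ∪ P → f v ∉ P := fun v hv hz hfv =>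
      hz (Or.inr (Forward.step v hv (fun hh => hz (Or.inl hh)) (fun hh => hz (Or.inr (hFP hh)))
        hfv))
    have hRP : IsWave D (Y ∪ S ∪ waveMax D (Y ∪ S) (Z ∪ S) ∪ P) (blocked D Y Z S ∪ P)
        (R \ P) f := by
      refine hf.diff ?_ (Set.union_subset_union_right _ hFP) hfP
      rintro u hu hn (hh | hh)
      exacts [hf.disj u hu hh, hn hh]
    obtain ⟨f₁, hf₁⟩ := exists_isWave_waveMax D (Y ∪ S) (Z ∪ S)
    have hf₁' : IsWave D (Y ∪ (S ∪ P)) (Z ∪ (S ∪ P)) (waveMax D (Y ∪ S) (Z ∪ S)) f₁ := by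
      refine hf₁.mono ?_ (Set.union_subset_union_right _ Set.subset_union_left)
      rintro u hu (hh | hh | hh)
      exacts [hf₁.disj u hu (Or.inl hh), hf₁.disj u hu (Or.inr hh),
        hPb u hh (waveMax_subset_blocked hu)]
    have hsub := (hf₁'.comp (R' := R \ P) (f' := f) (by
      rw [← Set.union_assoc, ← Set.union_assoc, Set.union_right_comm, Set.union_right_comm _ P]
      exact hRP)).subset_waveMax
    intro v hv
    by_cases hvb : v ∈ blocked D Y Z S ∪ P
    · rcases hvb with h | h
      exacts [hext.blocked_subset h, subset_blocked (Or.inr h)]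
    · have hvF : v ∉ blocked D Y Z S ∪ F := fun hh => hvb (Set.union_subset_union_right _ hFP hh)
      exact Or.inr ⟨f v, hsub (Or.inr ⟨hf.maps v hv hvF, hfP v hv hvb⟩), hf.adj v hv hvF⟩

theorem exists_isWave_nearWave {B : Set V} (hB : B.Finite) (h : B ⊆ nearWave D Y Z) :
    ∃ Q : Set V, Q.Finite ∧ ∃ H f, IsWave D Y (Z ∪ Q) H f ∧ H ⊆ nearWave D Y Z ∧ B ⊆ H := by
  have key : ∀ b : B, ∃ Q : Set V, Q.Finite ∧ ∃ H f, IsWave D Y (Z ∪ Q) H f ∧ b.1 ∈ H :=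
    fun b => h b.2
  choose Q hQ H f hf hb using key
  have := hB.to_subtype
  obtain ⟨g, hg⟩ := IsWave.iUnion (Y := Y) (Z := Z ∪ ⋃ b, Q b) fun b => (hf b).mono (hf b).disj
    (Set.union_subset_union_right _ (Set.subset_iUnion Q b))
  refine ⟨⋃ b, Q b, Set.finite_iUnion hQ, _, g, hg, fun v hv => ?_, fun b hb' =>
    Set.mem_iUnion.2 ⟨⟨b, hb'⟩, hb _⟩⟩
  exact ⟨_, Set.finite_iUnion hQ, _, g, hg, hv⟩

/-- The number of successors of finitely many bound vertices which can be made sources is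
bounded. -/
theorem exists_card_le_of_bound {S : Set V} (hb : (bound D Y Z S).Finite) :
    ∃ N : ℕ, ∀ F : Finset V, (∀ y ∈ F, y ∉ blocked D Y Z S) →
      (∀ y ∈ F, ∃ s ∈ bound D Y Z S, Adj D s y) →
      ¬ Hindered D (Y ∪ S ∪ waveMax D (Y ∪ S) (Z ∪ S)) (blocked D Y Z S ∪ F) → F.card ≤ N := by
  classical
  obtain ⟨Q, hQ, H, f, hf, hHn, hbH⟩ := exists_isWave_nearWave hb fun s hs => hs.2.2
  have hXfin : (Q ∪ {v | v ∈ nbr D H ∧ v ∉ Z ∪ Q ∧ f v ∈ bound D Y Z S}).Finite := by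
    refine hQ.union (Set.Finite.of_finite_image (f := f) (hb.subset ?_) ?_)
    · rintro _ ⟨v, hv, rfl⟩
      exact hv.2.2
    · exact fun v hv w hw he => hf.inj v hv.1 hv.2.1 w hw.1 hw.2.1 he
  set X := hXfin.toFinset with hX
  have hXmem : ∀ v, v ∈ X ↔ v ∈ Q ∨ v ∈ nbr D H ∧ v ∉ Z ∪ Q ∧ f v ∈ bound D Y Z S := by
    intro v
    rw [hX, Set.Finite.mem_toFinset]
    rfl
  refine ⟨X.card + X.card, fun F hFb hFs hun => ?_⟩
  have hZQ : ∀ v, v ∉ blocked D Y Z S → v ∉ X → v ∉ Z ∪ Q := by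
    rintro v hv hvX (hh | hh)
    exacts [hv (Or.inl (Or.inl hh)), hvX ((hXmem v).2 (Or.inl hh))]
  have hfv : ∀ v ∈ nbr D H, v ∉ blocked D Y Z S → v ∉ X →
      f v ∉ S ∪ waveMax D (Y ∪ S) (Z ∪ S) := by
    intro v hv hvb hvX
    have hvZ := hZQ v hvb hvX
    rintro (hh | hh)
    · refine hvX ((hXmem v).2 (Or.inr ⟨hv, hvZ, hh, fun hd => ?_, hHn (hf.maps v hv hvZ)⟩))
      exact hvb (hd v (hf.adj v hv hvZ))
    · exact hvb (Or.inr ⟨_, hh, hf.adj v hv hvZ⟩)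
  have hK : IsWave D (Y ∪ S ∪ waveMax D (Y ∪ S) (Z ∪ S)) (blocked D Y Z S ∪ F ∪ X)
      (H \ (S ∪ waveMax D (Y ∪ S) (Z ∪ S))) f := by
    refine hf.diff ?_ ?_ ?_
    · rintro u hu hn ((hh | hh) | hh)
      exacts [hf.disj u hu hh, hn (Or.inl hh), hn (Or.inr hh)]
    · rintro v (hv | hv)
      exacts [Or.inl (Or.inl (Or.inl (Or.inl hv))), Or.inr ((hXmem v).2 (Or.inl hv))]
    · exact fun v hv hz => hfv v hv (fun hh => hz (Or.inl (Or.inl hh))) fun hh => hz (Or.inr hh)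
  have hFH : ∀ y ∈ F, y ∈ nbr D H := fun y hy =>
    let ⟨s, hs, ha⟩ := hFs y hy
    ⟨s, hbH hs, ha⟩
  have hFX : ∀ y ∈ F \ X, y ∈ nbr D H ∧ y ∉ blocked D Y Z S ∧ y ∉ X := fun y hy =>
    ⟨hFH y (Finset.mem_sdiff.1 hy).1, hFb y (Finset.mem_sdiff.1 hy).1, (Finset.mem_sdiff.1 hy).2⟩
  have hcard : ((F \ X).image f).card = (F \ X).card := by
    refine Finset.card_image_of_injOn fun v hv w hw he => ?_
    have h1 := hFX v hv
    have h2 := hFX w hw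
    exact hf.inj v h1.1 (hZQ v h1.2.1 h1.2.2) w h2.1 (hZQ w h2.2.1 h2.2.2) he
  have hle : (F \ X).card ≤ X.card := by
    rw [← hcard]
    by_contra! hlt
    refine hun (hindered_of_card_lt X _ hK ?_ ?_ hlt)
    · intro e he
      obtain ⟨y, hy, rfl⟩ := Finset.mem_image.1 he
      have h1 := hFX y hy
      exact ⟨hf.maps y h1.1 (hZQ y h1.2.1 h1.2.2), hfv y h1.1 h1.2.1 h1.2.2⟩
    · intro e he v hv hz hfe
      obtain ⟨y, hy, rfl⟩ := Finset.mem_image.1 he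
      have h1 := hFX y hy
      have := hf.inj v (nbr_mono D Set.sdiff_subset hv)
        (hZQ v (fun hh => hz (Or.inl (Or.inl hh))) fun hh => hz (Or.inr hh)) y h1.1
        (hZQ y h1.2.1 h1.2.2) hfe
      exact hz (Or.inl (Or.inr (this ▸ (Finset.mem_sdiff.1 hy).1)))
  have := Finset.card_le_card_sdiff_add_card (s := F) (t := X)
  omega

/-- All bound vertices can be made dead. -/
theorem exists_extends_isDead {a : V} {S : Set V} (hS : IsSafe D Y Z a S)
    (hb : (bound D Y Z S).Finite) :
    ∃ S', IsSafe D Y Z a S' ∧ Extends D Y Z S S' ∧ (bound D Y Z S').Finite ∧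
      ∀ s ∈ bound D Y Z S, IsDead D Y Z S' s := by
  classical
  obtain ⟨N, hN⟩ := exists_card_le_of_bound hb
  let p : ℕ → Prop := fun n => ∃ F : Finset V, F.card = n ∧ (∀ y ∈ F, y ∉ blocked D Y Z S) ∧
      (∀ y ∈ F, ∃ s ∈ bound D Y Z S, Adj D s y) ∧
      ¬ Hindered D (Y ∪ S ∪ waveMax D (Y ∪ S) (Z ∪ S)) (blocked D Y Z S ∪ F)
  have hp0 : p 0 := ⟨∅, rfl, by simp, by simp, by
    rw [Finset.coe_empty, Set.union_empty]
    exact not_hindered_quotient⟩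
  obtain ⟨F, hFc, hFb, hFs, hFun⟩ := Nat.findGreatest_spec (P := p) (Nat.zero_le N) hp0
  obtain ⟨S', h1, h2, h3, h4, h5⟩ := exists_extends_of_not_hindered hS hb F.finite_toSet hFb
    (fun y hy => let ⟨s, hs, ha⟩ := hFs y hy; ⟨s, hs.1, ha⟩) hFun
  refine ⟨S', h1, h2, h4, fun s hs v hv => ?_⟩
  by_cases hvb : v ∈ blocked D Y Z S
  · exact h2.blocked_subset hvb
  by_cases hvF : v ∈ F
  · exact subset_blocked (h3 hvF)
  have hhind : Hindered D (Y ∪ S ∪ waveMax D (Y ∪ S) (Z ∪ S)) (blocked D Y Z S ∪ F ∪ {v}) := by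
    by_contra hcon
    have hins : ¬ Hindered D (Y ∪ S ∪ waveMax D (Y ∪ S) (Z ∪ S))
        (blocked D Y Z S ∪ (insert v F : Finset V)) := by
      rwa [Finset.coe_insert, Set.union_insert, ← Set.union_singleton]
    have hb' : ∀ y ∈ insert v F, y ∉ blocked D Y Z S := by
      intro y hy
      rcases Finset.mem_insert.1 hy with rfl | hy
      exacts [hvb, hFb y hy]
    have hs' : ∀ y ∈ insert v F, ∃ s ∈ bound D Y Z S, Adj D s y := by
      intro y hy
      rcases Finset.mem_insert.1 hy with rfl | hy
      exacts [⟨s, hs, hv⟩, hFs y hy]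
    have := Nat.le_findGreatest (P := p) (hN _ hb' hs' hins) ⟨_, rfl, hb', hs', hins⟩
    rw [Finset.card_insert_of_notMem hvF] at this
    omega
  obtain ⟨R, f, hw, hvR⟩ := exists_isWave_of_hindered_insert hFun (by simp [hvb, hvF]) hhind
  exact h5 (nbr_mono D hw.subset_waveMax hvR)

theorem exists_extends_bound_eq_empty {a : V} {S : Set V} (hS : IsSafe D Y Z a S)
    (hb : (bound D Y Z S).Finite) :
    ∃ S', IsSafe D Y Z a S' ∧ Extends D Y Z S S' ∧ bound D Y Z S' = ∅ := by
  choose g hg1 hg2 hg3 hg4 using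
    fun S : {S : Set V // IsSafe D Y Z a S ∧ (bound D Y Z S).Finite} =>
      exists_extends_isDead S.2.1 S.2.2
  let s : ℕ → {S : Set V // IsSafe D Y Z a S ∧ (bound D Y Z S).Finite} := fun n =>
    (fun S => ⟨g S, hg1 S, hg3 S⟩)^[n] ⟨S, hS, hb⟩
  have hs : ∀ n, (s (n + 1)).1 = g (s n) := fun n => by
    simp only [s, Function.iterate_succ_apply']
  have hmono : ∀ m n, m ≤ n → Extends D Y Z (s m).1 (s n).1 := by
    intro m n h
    induction n, h using Nat.le_induction with
    | base => exact Extends.refl _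
    | succ n _ ih => exact ih.trans (hs n ▸ hg2 (s n))
  obtain ⟨h1, h2⟩ := IsSafe.sUnion (c := Set.range fun n => (s n).1) (D := D) (Y := Y) (Z := Z)
    (a := a) (by rintro _ ⟨n, rfl⟩; exact (s n).2.1) (Set.range_nonempty _) (by
      rintro _ ⟨m, rfl⟩ _ ⟨n, rfl⟩
      exact (le_total m n).imp (hmono m n) (hmono n m))
  refine ⟨_, h1, h2 _ ⟨0, rfl⟩, bound_sUnion h2 ?_⟩
  rintro _ ⟨n, rfl⟩ t ht
  exact ⟨_, ⟨n + 1, hs n⟩, hg4 (s n) t ht⟩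

theorem exists_isSafe_forall_isDead {a : V} {S : Set V} (hS : IsSafe D Y Z a S)
    (hb : (bound D Y Z S).Finite) :
    ∃ S', IsSafe D Y Z a S' ∧ ∀ s ∈ S', IsDead D Y Z S' s := by
  let r : {S : Set V // IsSafe D Y Z a S ∧ bound D Y Z S = ∅} →
    {S : Set V // IsSafe D Y Z a S ∧ bound D Y Z S = ∅} → Prop := fun S S' =>
      Extends D Y Z S.1 S'.1
  obtain ⟨M, hM⟩ := exists_maximal_of_chains_bounded (r := r) (fun c hc => by
      rcases c.eq_empty_or_nonempty with rfl | hne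
      · obtain ⟨S', h1, -, h3⟩ := exists_extends_bound_eq_empty hS hb
        exact ⟨⟨S', h1, h3⟩, by simp⟩
      obtain ⟨h1, h2⟩ := IsSafe.sUnion (c := Subtype.val '' c) (D := D) (Y := Y) (Z := Z)
        (a := a) (by rintro _ ⟨S, -, rfl⟩; exact S.2.1) (hne.image _) (by
          rintro _ ⟨S, hS, rfl⟩ _ ⟨S', hS', rfl⟩
          by_cases he : S = S'
          · exact Or.inl (he ▸ Extends.refl _)
          · exact hc hS hS' he)
      refine ⟨⟨_, h1, bound_sUnion h2 ?_⟩, fun S hS => h2 _ ⟨S, hS, rfl⟩⟩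
      rintro _ ⟨S, -, rfl⟩ t ht
      rw [S.2.2] at ht
      exact absurd ht (Set.notMem_empty t)) fun h h' => Extends.trans h h'
  refine ⟨M.1, M.2.1, fun s hs y hsy => ?_⟩
  by_contra hy
  have hun : ¬ Hindered D (Y ∪ M.1 ∪ waveMax D (Y ∪ M.1) (Z ∪ M.1))
      (blocked D Y Z M.1 ∪ {y}) := by
    intro hh
    obtain ⟨R, f, hw, hyR⟩ := exists_isWave_of_hindered_insert not_hindered_quotient hy hh
    rw [eq_empty_of_isWave_quotient hw, nbr_empty] at hyR
    exact hyR
  obtain ⟨S', h1, h2, h3, h4, -⟩ := exists_extends_of_not_hindered M.2.1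
    (by rw [M.2.2]; exact Set.finite_empty) (Set.finite_singleton y) (by simpa using hy)
    (by simpa using ⟨s, hs, hsy⟩) hun
  obtain ⟨S'', h5, h6, h7⟩ := exists_extends_bound_eq_empty h1 h4
  exact hy (subset_blocked ((hM ⟨S'', h5, h7⟩ (h2.trans h6)).1 (h6.1 (h3 rfl))))

open Classical in
theorem hindered_of_forall_isDead {a : V} {S : Set V} (ha : a ∈ Z) (haS : a ∈ S)
    (hSY : ∀ s ∈ S, s ∉ Y) (hd : ∀ s ∈ S, IsDead D (Y ∪ {a}) Z S s) : Hindered D Y Z := by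
  obtain ⟨f, hf⟩ := exists_isWave_waveMax D (Y ∪ {a} ∪ S) (Z ∪ S)
  have hRS : ∀ u ∈ waveMax D (Y ∪ {a} ∪ S) (Z ∪ S), u ∉ S := fun u hu hh => hf.disj u hu (Or.inr hh)
  have hnb : ∀ v ∈ nbr D (S ∪ waveMax D (Y ∪ {a} ∪ S) (Z ∪ S)), v ∉ Z → v ∉ S →
      v ∈ nbr D (waveMax D (Y ∪ {a} ∪ S) (Z ∪ S)) ∧ v ∉ Z ∪ S := by
    rintro v ⟨u, hu, huv⟩ hz hvS
    have hvZ : v ∉ Z ∪ S := by simp [hz, hvS]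
    rcases hu with hu | hu
    exacts [⟨(hd u hu v huv).resolve_left hvZ, hvZ⟩, ⟨⟨u, hu, huv⟩, hvZ⟩]
  refine ⟨S ∪ waveMax D (Y ∪ {a} ∪ S) (Z ∪ S), fun v => if v ∈ S then v else f v,
    ⟨?_, ?_, ?_, ?_, ?_⟩, a, Or.inl haS, ?_⟩
  · rintro u (hu | hu)
    exacts [hSY u hu, fun hh => hf.disj u hu (Or.inl (Or.inl hh))]
  · intro v hv hz
    split_ifs with hc
    exacts [Or.inl hc, Or.inr (hf.maps v (hnb v hv hz hc).1 (hnb v hv hz hc).2)]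
  · intro v hv hz
    split_ifs with hc
    exacts [Or.inl rfl, hf.adj v (hnb v hv hz hc).1 (hnb v hv hz hc).2]
  · intro v hv hz w hw hwz
    have aux : ∀ v, v ∈ nbr D (S ∪ waveMax D (Y ∪ {a} ∪ S) (Z ∪ S)) → v ∉ Z → v ∉ S → f v ∉ S :=
      fun v hv hz hc => hRS _ (hf.maps v (hnb v hv hz hc).1 (hnb v hv hz hc).2)
    split_ifs with hc hc' hc'
    · exact id
    · exact fun he => absurd (he ▸ hc) (aux w hw hwz hc')
    · exact fun he => absurd (he ▸ hc') (aux v hv hz hc)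
    · exact hf.inj v (hnb v hv hz hc).1 (hnb v hv hz hc).2 w (hnb w hw hwz hc').1
        (hnb w hw hwz hc').2
  · intro r hr hray
    have hrS : ∀ n, r n ∉ S := fun n hn => by
      have := (hray n).2.2
      rw [if_pos hn] at this
      exact absurd (hr this) (by omega)
    refine hf.noRay r hr fun n => ?_
    have h1 := hray n
    rw [if_neg (hrS n)] at h1
    exact ⟨(hnb _ h1.1 h1.2.1 (hrS n)).1, (hnb _ h1.1 h1.2.1 (hrS n)).2, h1.2.2⟩
  · intro v hv hz
    dsimp only
    split_ifs with hc
    · rintro rfl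
      exact hz ha
    · exact fun he => hRS _ (hf.maps v (hnb v hv hz hc).1 (hnb v hv hz hc).2) (he ▸ haS)

/-- Every source can be linked to a target by a finite path whose deletion leaves the web
unhindered. -/
theorem exists_safe_link {a : V} (hun : ¬ Hindered D Y Z) (ha : a ∈ Z) (haY : a ∉ Y) :
    ∃ Q : Set V, Q.Finite ∧ a ∈ Q ∧ (∀ q ∈ Q, q ∈ Z → q = a) ∧ (∃ b ∈ Y ∩ Q, Conn D Q a b) ∧
      ¬ Hindered D (Y ∪ Q) (Z ∪ Q) := by
  by_cases hex : ∃ S, IsSafe D (Y ∪ {a}) Z a S ∧ ∃ b ∈ S, b ∈ Y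
  · obtain ⟨S, hS, b, hb, hbY⟩ := hex
    obtain ⟨T, hT, hTf, hab⟩ := (hS.conn b hb).exists_finite
    obtain ⟨Q, hQS, hQ, hTQ, hQun⟩ := hS.safe (T ∪ {a, b})
      (Set.union_subset hT (Set.insert_subset hS.mem (Set.singleton_subset_iff.2 hb)))
      (hTf.union (Set.toFinite _))
    have haQ : a ∈ Q := hTQ (Or.inr (Or.inl rfl))
    refine ⟨Q, hQ, haQ, fun q hq => hS.eq_root q (hQS hq), ⟨b, ⟨hbY, hTQ (Or.inr (Or.inr rfl))⟩,
      hab.mono (Set.subset_union_left.trans hTQ)⟩, ?_⟩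
    rwa [Set.union_assoc, Set.union_eq_self_of_subset_left (Set.singleton_subset_iff.2 haQ)]
      at hQun
  · push Not at hex
    have hsafe : IsSafe D (Y ∪ {a}) Z a {a} := by
      refine ⟨rfl, fun s hs _ => hs, ?_, fun T hT _ => ⟨{a}, subset_rfl, Set.finite_singleton a,
        hT, fun hh => hun (hh.mono ?_ ?_)⟩⟩
      · rintro s rfl
        exact Relation.ReflTransGen.refl
      · exact fun v hv => Or.inl (Or.inl hv)
      · exact Set.union_subset subset_rfl (Set.singleton_subset_iff.2 ha)
    obtain ⟨S, hS, hd⟩ := exists_isSafe_forall_isDead hsafe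
      ((Set.finite_singleton a).subset fun s hs => hs.1)
    exact absurd (hindered_of_forall_isDead ha hS.mem (hex S hS) hd) hun

/-- The sources in `M` can be linked to targets inside `M` by disjoint paths. -/
def Link (D : V → V → Prop) (Y Z M : Set V) : Prop :=
  ∃ P : V → Set V, (∀ a ∈ M, a ∈ Z → a ∉ Y → a ∈ P a ∧ P a ⊆ M ∧ (∀ q ∈ P a, q ∈ Z → q = a) ∧
      ∃ b ∈ Y ∩ P a, Conn D (P a) a b) ∧
    ∀ a ∈ M, a ∈ Z → a ∉ Y → ∀ a' ∈ M, a' ∈ Z → a' ∉ Y → a ≠ a' → Disjoint (P a) (P a')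

theorem Link.mono {M W : Set V} (h : Link D Y Z W) (hWM : W ⊆ M)
    (hM : ∀ a ∈ M, a ∈ Z → a ∉ Y → a ∈ W) : Link D Y Z M := by
  obtain ⟨P, h1, h2⟩ := h
  refine ⟨P, fun a ha hZ hY => ?_, fun a ha hZ hY a' ha' hZ' hY' =>
    h2 a (hM a ha hZ hY) hZ hY a' (hM a' ha' hZ' hY') hZ' hY'⟩
  obtain ⟨h3, h4, h5⟩ := h1 a (hM a ha hZ hY) hZ hY
  exact ⟨h3, h4.trans hWM, h5⟩

/-- Links of a well-ordered sequence of deletions can be combined. -/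
theorem Link.iUnion {I : Type*} [LinearOrder I] [WellFoundedLT I] {M N : I → Set V}
    (hN : ∀ i, N i = ⋃ j < i, M j) (h : ∀ i, Link D (Y ∪ N i) (Z ∪ N i) (M i)) :
    Link D Y Z (⋃ i, M i) := by
  classical
  rcases isEmpty_or_nonempty I with hI | hI
  · exact ⟨fun _ => ∅, by simp, by simp⟩
  choose P hP1 hP2 using h
  have hleast : ∀ a ∈ ⋃ i, M i, ∃ i, a ∈ M i ∧ a ∉ N i := by
    intro a ha
    rw [Set.mem_iUnion] at ha
    obtain ⟨i, hi, hmin⟩ := WellFounded.has_min (wellFounded_lt (α := I)) {i | a ∈ M i} ha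
    refine ⟨i, hi, ?_⟩
    rw [hN]
    simp only [Set.mem_iUnion, not_exists]
    exact fun j hj hm => hmin j hm hj
  choose! idx hidx using hleast
  have key : ∀ a ∈ ⋃ i, M i, a ∈ Z → a ∉ Y → a ∈ P (idx a) a ∧ P (idx a) a ⊆ M (idx a) ∧
      (∀ q ∈ P (idx a) a, q ∈ Z ∪ N (idx a) → q = a) ∧
      ∃ b ∈ (Y ∪ N (idx a)) ∩ P (idx a) a, Conn D (P (idx a) a) a b := fun a ha hZ hY =>
    hP1 _ a (hidx a ha).1 (Or.inl hZ) fun hh => hh.elim hY (hidx a ha).2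
  have hMN : ∀ i j, i < j → M i ⊆ N j := by
    intro i j hij
    rw [hN]
    exact Set.subset_biUnion_of_mem (u := fun i => M i) hij
  refine ⟨fun a => P (idx a) a, fun a ha hZ hY => ?_, fun a ha hZ hY a' ha' hZ' hY' hne => ?_⟩
  · obtain ⟨h1, h2, h3, b, ⟨hb, hbP⟩, h4⟩ := key a ha hZ hY
    refine ⟨h1, h2.trans (Set.subset_iUnion M _), fun q hq hqZ => h3 q hq (Or.inl hqZ), b,
      ⟨hb.resolve_right fun hbN => ?_, hbP⟩, h4⟩
    exact (hidx a ha).2 (h3 b hbP (Or.inr hbN) ▸ hbN)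
  · obtain ⟨-, h2, h3, -⟩ := key a ha hZ hY
    obtain ⟨-, h2', h3', -⟩ := key a' ha' hZ' hY'
    rcases lt_trichotomy (idx a) (idx a') with hlt | heq | hlt
    · rw [Set.disjoint_left]
      intro q hq hq'
      have hqN := hMN _ _ hlt (h2 hq)
      exact (hidx a' ha').2 (h3' q hq' (Or.inr hqN) ▸ hqN)
    · have := hP2 (idx a') a (heq ▸ (hidx a ha).1) (Or.inl hZ)
        (fun hh => hh.elim hY (heq ▸ (hidx a ha).2)) a' (hidx a' ha').1 (Or.inl hZ')
        (fun hh => hh.elim hY' (hidx a' ha').2) hne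
      change Disjoint (P (idx a) a) (P (idx a') a')
      rwa [heq]
    · rw [Set.disjoint_left]
      intro q hq hq'
      have hqN := hMN _ _ hlt (h2' hq')
      exact (hidx a ha).2 (h3 q hq (Or.inr hqN) ▸ hqN)

theorem Link.iUnion_nat {K : ℕ → Set V} (hmono : ∀ n, K n ⊆ K (n + 1)) (h0 : K 0 = ∅)
    (h : ∀ n, Link D (Y ∪ K n) (Z ∪ K n) (K (n + 1))) : Link D Y Z (⋃ n, K n) := by
  have hm : Monotone K := monotone_nat_of_le_succ hmono
  have hN : ∀ n, K n = ⋃ j < n, K (j + 1) := by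
    intro n
    refine subset_antisymm ?_ (Set.iUnion₂_subset fun j hj => hm hj)
    cases n with
    | zero => simp [h0]
    | succ n => exact Set.subset_biUnion_of_mem (u := fun j => K (j + 1)) (Nat.lt_succ_self n)
  have := Link.iUnion hN h
  rwa [show ⋃ n, K n = ⋃ n, K (n + 1) from subset_antisymm
    (Set.iUnion_subset fun n => (hmono n).trans (Set.subset_iUnion (fun n => K (n + 1)) n))
    (Set.iUnion_subset fun n => Set.subset_iUnion K (n + 1))]

/-- The existence of closed sets of size at most `μ` whose sources can be linked. -/
def Linkable (D : V → V → Prop) (μ : Cardinal.{u}) : Prop :=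
  ∀ Y Z : Set V, ¬ Hindered D Y Z → ∀ φ : Finset V → Set V, (∀ e, #(φ e) ≤ μ) →
    ∀ U : Set V, #U ≤ μ → ∃ M, U ⊆ M ∧ #M ≤ μ ∧ (∀ e : Finset V, ↑e ⊆ M → φ e ⊆ M) ∧ Link D Y Z M

theorem mk_union_le {κ : Cardinal.{u}} (hκ : ℵ₀ ≤ κ) {S T : Set V} (hS : #S ≤ κ) (hT : #T ≤ κ) :
    #(S ∪ T : Set V) ≤ κ :=
  (Cardinal.mk_union_le S T).trans (add_le_of_le hκ hS hT)

theorem mk_iUnion_le_of_le {κ : Cardinal.{u}} (hκ : ℵ₀ ≤ κ) {ι : Type u} (hι : #ι ≤ κ)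
    {S : ι → Set V} (hS : ∀ i, #(S i) ≤ κ) : #(⋃ i, S i) ≤ κ :=
  (mk_iUnion_le_sum_mk.trans (sum_le_mk_mul_iSup _)).trans
    (mul_le_of_le hκ hι (ciSup_le' hS))

theorem mk_iUnion_nat_le {κ : Cardinal.{u}} (hκ : ℵ₀ ≤ κ)
    {S : ℕ → Set V} (hS : ∀ i, #(S i) ≤ κ) : #(⋃ i, S i) ≤ κ := by
  have := mk_iUnion_le_of_le (ι := ULift.{u} ℕ) hκ (by simpa using hκ) (S := fun i => S i.down)
    fun i => hS _
  rwa [show ⋃ i : ULift.{u} ℕ, S i.down = ⋃ i, S i by ext; simp] at this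

theorem mk_finset_le {κ : Cardinal.{u}} (hκ : ℵ₀ ≤ κ) {S : Set V} (hS : #S ≤ κ) :
    #{e : Finset V // ↑e ⊆ S} ≤ κ := by
  classical
  refine (mk_le_of_surjective (f := fun e : Finset S =>
    (⟨e.map (Function.Embedding.subtype _), by simp⟩ : {e : Finset V // ↑e ⊆ S})) ?_).trans
    (?_ : #(Finset S) ≤ κ)
  · rintro ⟨e, he⟩
    refine ⟨e.subtype (· ∈ S), Subtype.ext ?_⟩
    exact Finset.subtype_map_of_mem he
  · rcases finite_or_infinite S with hf | hf
    · exact ((lt_aleph0_of_finite _).le).trans hκ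
    · rwa [mk_finset_of_infinite]

theorem exists_finset_subset {I : Type*} [LinearOrder I] [Nonempty I] {K : I → Set V}
    (hm : Monotone K) {e : Finset V} (he : ↑e ⊆ ⋃ i, K i) : ∃ i, ↑e ⊆ K i := by
  classical
  induction e using Finset.induction_on with
  | empty => exact ⟨Classical.arbitrary I, by simp⟩
  | insert a s _ ih =>
    obtain ⟨i, hi⟩ := ih fun x hx => he (Finset.mem_coe.2 (Finset.mem_insert_of_mem hx))
    obtain ⟨j, hj⟩ := Set.mem_iUnion.1 (he (Finset.mem_coe.2 (Finset.mem_insert_self a s)))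
    refine ⟨max i j, ?_⟩
    rw [Finset.coe_insert]
    exact Set.insert_subset (hm (le_max_right i j) hj) (hi.trans (hm (le_max_left i j)))

theorem exists_closed {κ : Cardinal.{u}} (hκ : ℵ₀ ≤ κ) {φ : Finset V → Set V}
    (hφ : ∀ e, #(φ e) ≤ κ) {U : Set V} (hU : #U ≤ κ) :
    ∃ M, U ⊆ M ∧ #M ≤ κ ∧ ∀ e : Finset V, ↑e ⊆ M → φ e ⊆ M := by
  let g : Set V → Set V := fun K => K ∪ ⋃ e : {e : Finset V // ↑e ⊆ K}, φ e
  have hs : ∀ n, g^[n + 1] U = g (g^[n] U) := fun n => Function.iterate_succ_apply' g n U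
  have hcard : ∀ n, #(g^[n] U) ≤ κ := by
    intro n
    induction n with
    | zero => exact hU
    | succ n ih =>
      rw [hs]
      exact mk_union_le hκ ih (mk_iUnion_le_of_le hκ (mk_finset_le hκ ih) fun e => hφ e)
  have hm : Monotone fun n => g^[n] U := monotone_nat_of_le_succ fun n => by
    rw [hs]
    exact Set.subset_union_left
  refine ⟨⋃ n, g^[n] U, Set.subset_iUnion (fun n => g^[n] U) 0, mk_iUnion_nat_le hκ hcard,
    fun e he => ?_⟩
  obtain ⟨n, hn⟩ := exists_finset_subset hm he
  refine LE.le.trans ?_ (Set.subset_iUnion (fun n => g^[n] U) (n + 1))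
  rw [hs]
  exact (Set.subset_iUnion (fun e : {e : Finset V // ↑e ⊆ g^[n] U} => φ e) ⟨e, hn⟩).trans
    Set.subset_union_right

theorem linkable_aleph0 : Linkable D (ℵ₀ : Cardinal.{u}) := by
  classical
  intro Y Z hun φ hφ U hU
  have hsl : ∀ (X : Finset V) (a : V), ∃ Q : Finset V, ¬ Hindered D (Y ∪ X) (Z ∪ X) →
      a ∈ Z ∪ X → a ∉ Y ∪ X → a ∈ Q ∧ (∀ q ∈ Q, q ∈ Z ∪ X → q = a) ∧
        (∃ b ∈ (Y ∪ X) ∩ (Q : Set V), Conn D Q a b) ∧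
        ¬ Hindered D (Y ∪ X ∪ Q) (Z ∪ X ∪ Q) := by
    intro X a
    by_cases h : ¬ Hindered D (Y ∪ X) (Z ∪ X) ∧ a ∈ Z ∪ (X : Set V) ∧ a ∉ Y ∪ (X : Set V)
    · obtain ⟨Q, hQf, h1, h2, h3, h4⟩ := exists_safe_link h.1 h.2.1 h.2.2
      lift Q to Finset V using hQf
      exact ⟨Q, fun _ _ _ => ⟨h1, h2, h3, h4⟩⟩
    · exact ⟨∅, fun h1 h2 h3 => absurd ⟨h1, h2, h3⟩ h⟩
  choose q hq using hsl
  let ψ : Finset V → Set V := fun e =>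
    φ e ∪ ⋃ p : {p : Finset V × V // p.1 ⊆ e ∧ p.2 ∈ e}, (q p.1.1 p.1.2 : Set V)
  have hψ : ∀ e, #(ψ e) ≤ ℵ₀ := by
    intro e
    refine mk_union_le le_rfl (hφ e) (mk_iUnion_le_of_le le_rfl ?_ fun p => ?_)
    · have : Finite {p : Finset V × V // p.1 ⊆ e ∧ p.2 ∈ e} := by
        have : Finite ((e.powerset ×ˢ e : Finset (Finset V × V)) : Set (Finset V × V)) := inferInstance
        exact Finite.of_injective (β := ((e.powerset ×ˢ e : Finset (Finset V × V)) : Set (Finset V × V)))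
          (fun p => ⟨p.1, by simpa using p.2⟩) fun p p' h => Subtype.ext (congrArg (fun t => t.1) h)
      exact (lt_aleph0_of_finite _).le
    · exact (lt_aleph0_of_finite _).le
  obtain ⟨M, hUM, hM, hcl⟩ := exists_closed le_rfl hψ hU
  refine ⟨M, hUM, hM, fun e he => Set.subset_union_left.trans (hcl e he), ?_⟩
  have hqM : ∀ (X : Finset V) (a : V), ↑X ⊆ M → a ∈ M → ↑(q X a) ⊆ M := by
    intro X a hX ha
    refine LE.le.trans ?_ (hcl (insert a X) (by
      rw [Finset.coe_insert]; exact Set.insert_subset ha hX))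
    refine LE.le.trans ?_ Set.subset_union_right
    exact Set.subset_iUnion (fun p : {p : Finset V × V // p.1 ⊆ insert a X ∧ p.2 ∈ insert a X} =>
      (q p.1.1 p.1.2 : Set V)) ⟨(X, a), Finset.subset_insert _ _, Finset.mem_insert_self _ _⟩
  rcases M.eq_empty_or_nonempty with rfl | hne
  · exact ⟨fun _ => ∅, by simp, by simp⟩
  obtain ⟨en, hen⟩ := (le_aleph0_iff_set_countable.1 hM).exists_eq_range hne
  obtain ⟨X, hX0, hXs⟩ : ∃ X : ℕ → Finset V, X 0 = ∅ ∧ ∀ n, X (n + 1) =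
      if en n ∈ Z ∪ (X n : Set V) ∧ en n ∉ Y ∪ (X n : Set V) then X n ∪ q (X n) (en n) else X n :=
    ⟨fun n => Nat.rec ∅ (fun n K => if en n ∈ Z ∪ (K : Set V) ∧ en n ∉ Y ∪ (K : Set V) then
      K ∪ q K (en n) else K) n, rfl, fun _ => rfl⟩
  have henM : ∀ n, en n ∈ M := fun n => hen ▸ Set.mem_range_self n
  have hinv : ∀ n, ↑(X n) ⊆ M ∧ ¬ Hindered D (Y ∪ X n) (Z ∪ X n) := by
    intro n
    induction n with
    | zero => simpa [hX0] using hun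
    | succ n ih =>
      rw [hXs]
      split_ifs with h
      · rw [Finset.coe_union, ← Set.union_assoc, ← Set.union_assoc]
        exact ⟨Set.union_subset ih.1 (hqM _ _ ih.1 (henM n)), (hq _ _ ih.2 h.1 h.2).2.2.2⟩
      · exact ih
  have hmono : ∀ n, (X n : Set V) ⊆ X (n + 1) := by
    intro n
    rw [hXs]
    split_ifs with h
    · rw [Finset.coe_union]
      exact Set.subset_union_left
    · exact subset_rfl
  have hlink : Link D Y Z (⋃ n, (X n : Set V)) := by
    refine Link.iUnion_nat hmono (by simp [hX0]) fun n => ?_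
    rw [hXs]
    split_ifs with h
    · obtain ⟨h1, h2, h3, -⟩ := hq _ _ (hinv n).2 h.1 h.2
      have huniq : ∀ a ∈ ((X n ∪ q (X n) (en n) : Finset V) : Set V), a ∈ Z ∪ (X n : Set V) →
          a ∉ Y ∪ (X n : Set V) → a = en n := by
        intro a ha hZ hY
        rw [Finset.coe_union] at ha
        exact h2 a (Finset.mem_coe.1 (ha.resolve_left fun hh => hY (Or.inr hh))) hZ
      refine ⟨fun _ => q (X n) (en n), fun a ha hZ hY => ?_, fun a ha hZ hY a' ha' hZ' hY' hne => ?_⟩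
      · obtain rfl := huniq a ha hZ hY
        refine ⟨h1, ?_, fun p hp hpZ => h2 p hp hpZ, h3⟩
        rw [Finset.coe_union]
        exact Set.subset_union_right
      · exact absurd ((huniq a ha hZ hY).trans (huniq a' ha' hZ' hY').symm) hne
    · exact ⟨fun _ => ∅, fun a ha hZ hY => absurd (Or.inr ha) hY,
        fun a ha hZ hY => absurd (Or.inr ha) hY⟩
  refine hlink.mono (Set.iUnion_subset fun n => (hinv n).1) fun a ha hZ hY => ?_
  rw [hen] at ha
  obtain ⟨n, rfl⟩ := ha
  by_cases hn : en n ∈ (X n : Set V)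
  · exact Set.mem_iUnion.2 ⟨n, hn⟩
  · refine Set.mem_iUnion.2 ⟨n + 1, ?_⟩
    have hc : en n ∈ Z ∪ (X n : Set V) ∧ en n ∉ Y ∪ (X n : Set V) :=
      ⟨Or.inl hZ, fun hh => hh.elim hY hn⟩
    rw [hXs, if_pos hc, Finset.coe_union]
    exact Or.inr (hq _ _ (hinv n).2 hc.1 hc.2).1

theorem Linkable.exists_lt {μ : Cardinal.{u}} (hμ : ℵ₀ < μ) (hreg : μ.IsRegular)
    (ih : ∀ ρ, ℵ₀ ≤ ρ → ρ < μ → Linkable D ρ) (hun : ¬ Hindered D Y Z)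
    {ψ : Finset V → Set V} (hψ : ∀ e, #(ψ e) < μ) {W : Set V} (hW : #W < μ) :
    ∃ M, W ⊆ M ∧ #M < μ ∧ (∀ e : Finset V, ↑e ⊆ M → ψ e ⊆ M) ∧ Link D Y Z M := by
  have hunion : ∀ {ι : Type u} (t : ι → Set V), #ι < μ → (∀ i, #(t i) < μ) → #(⋃ i, t i) < μ :=
    fun t hι ht => (card_iUnion_lt_iff_forall_of_isRegular hreg hι).2 ht
  have hfin : ∀ S : Set V, #S < μ → #{e : Finset V // ↑e ⊆ S} < μ := fun S hS =>
    (mk_finset_le (le_max_left ℵ₀ #S) (le_max_right _ _)).trans_lt (max_lt hμ hS)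
  have hstep : ∀ K : Set V, ∃ K', #K < μ → ¬ Hindered D (Y ∪ K) (Z ∪ K) →
      (K ∪ W ∪ ⋃ e : {e : Finset V // ↑e ⊆ K}, ψ e) ⊆ K' ∧ #K' < μ ∧
      ¬ Hindered D (Y ∪ K') (Z ∪ K') ∧ Link D (Y ∪ K) (Z ∪ K) K' := by
    intro K
    by_cases hK : #K < μ ∧ ¬ Hindered D (Y ∪ K) (Z ∪ K)
    swap
    · exact ⟨∅, fun h1 h2 => absurd ⟨h1, h2⟩ hK⟩
    set A := K ∪ W ∪ ⋃ e : {e : Finset V // ↑e ⊆ K}, ψ e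
    have hA : #A < μ := mk_union_lt hμ.le (mk_union_lt hμ.le hK.1 hW)
      (hunion _ (hfin K hK.1) fun e => hψ e)
    have hρ : ℵ₀ ≤ max ℵ₀ #A := le_max_left _ _
    obtain ⟨φ, hφ, hgood⟩ := exists_closure_unhindered
      (hρ.trans_lt (Order.lt_succ (max ℵ₀ #A))) (isRegular_succ hρ) hun
    have hρμ : max ℵ₀ #A < μ := max_lt hμ hA
    obtain ⟨K', h1, h2, h3, h4⟩ := ih _ hρ hρμ _ _ hK.2 φ
      (fun e => Order.lt_succ_iff.1 (hφ e)) A (le_max_right _ _)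
    exact ⟨K', fun _ _ => ⟨h1, h2.trans_lt hρμ, hgood K' (Order.lt_succ_iff.2 h2) h3, h4⟩⟩
  choose k hk using hstep
  have hs : ∀ n, k^[n + 1] ∅ = k (k^[n] ∅) := fun n => Function.iterate_succ_apply' k n ∅
  have hinv : ∀ n, #(k^[n] ∅ : Set V) < μ ∧ ¬ Hindered D (Y ∪ k^[n] ∅) (Z ∪ k^[n] ∅) := by
    intro n
    induction n with
    | zero => simpa using ⟨zero_le.trans_lt hμ, hun⟩
    | succ n ih =>
      rw [hs]
      exact ⟨(hk _ ih.1 ih.2).2.1, (hk _ ih.1 ih.2).2.2.1⟩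
  have hsub : ∀ n, _ ⊆ k^[n + 1] ∅ := fun n => (hs n).symm ▸ (hk _ (hinv n).1 (hinv n).2).1
  have hmono : ∀ n, k^[n] ∅ ⊆ k^[n + 1] ∅ := fun n =>
    (Set.subset_union_left.trans Set.subset_union_left).trans (hsub n)
  refine ⟨⋃ n, k^[n] ∅, ?_, ?_, fun e he => ?_, ?_⟩
  · exact ((Set.subset_union_right.trans Set.subset_union_left).trans (hsub 0)).trans
      (Set.subset_iUnion (fun n => k^[n] ∅) 1)
  · have := hunion (ι := ULift.{u} ℕ) (fun i => k^[i.down] ∅) (by simpa using hμ)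
      fun i => (hinv _).1
    rwa [show ⋃ i : ULift.{u} ℕ, k^[i.down] ∅ = ⋃ i, k^[i] ∅ by ext; simp] at this
  · obtain ⟨n, hn⟩ := exists_finset_subset (monotone_nat_of_le_succ hmono) he
    refine LE.le.trans ?_ (Set.subset_iUnion (fun n => k^[n] ∅) (n + 1))
    exact (Set.subset_iUnion (fun e : {e : Finset V // ↑e ⊆ k^[n] ∅} => ψ e) ⟨e, hn⟩).trans
      (Set.subset_union_right.trans (hsub n))
  · refine Link.iUnion_nat hmono rfl fun n => ?_
    rw [hs]
    exact (hk _ (hinv n).1 (hinv n).2).2.2.2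

/-- A set of size at most `#I` is a union of at most `#I` subsingletons. -/
theorem exists_subsingleton_iUnion {I : Type u} [Nonempty I] {S : Set V} (hS : #S ≤ #I) :
    ∃ g : I → Set V, (∀ i, (g i).Subsingleton) ∧ ⋃ i, g i = S := by
  obtain ⟨j⟩ := hS
  refine ⟨fun i => {v | ∃ h : v ∈ S, j ⟨v, h⟩ = i}, ?_, ?_⟩
  · rintro i v ⟨h, rfl⟩ w ⟨h', e⟩
    exact congrArg Subtype.val (j.injective e).symm
  · ext v
    simp

theorem linkable_of_isRegular {μ : Cardinal.{u}} (hμ : ℵ₀ < μ) (hreg : μ.IsRegular)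
    (ih : ∀ ρ, ℵ₀ ≤ ρ → ρ < μ → Linkable D ρ) : Linkable D μ := by
  classical
  intro Y Z hun φ hφ U hU
  have hunion : ∀ {ι : Type u} (t : ι → Set V), #ι < μ → (∀ i, #(t i) < μ) → #(⋃ i, t i) < μ :=
    fun t hι ht => (card_iUnion_lt_iff_forall_of_isRegular hreg hι).2 ht
  obtain ⟨I, _, _, _, hI, hIio, hIoi⟩ := exists_wellOrder μ hμ.le
  obtain ⟨φ', hφ', hgood⟩ := exists_closure_unhindered hμ hreg hun
  obtain ⟨u, hu, hu'⟩ := exists_subsingleton_iUnion (I := I) (hI ▸ hU)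
  have : ∀ e, ∃ g : I → Set V, (∀ i, (g i).Subsingleton) ∧ ⋃ i, g i = φ e := fun e =>
    exists_subsingleton_iUnion (hI ▸ hφ e)
  choose g hg hg' using this
  have hsing : ∀ S : Set V, S.Subsingleton → #S < μ := fun S hS =>
    mk_lt_of_finite hμ.le hS.finite
  let N : I → (I → Set V) → Set V := fun i M => ⋃ j : Set.Iio i, M j
  have hIic : ∀ i : I, #(Set.Iic i) < μ := fun i => by
    rw [← Set.Iio_insert]
    exact mk_union_lt hμ.le (mk_lt_of_finite hμ.le (Set.finite_singleton i)) (hIio i)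
  let ψ : I → Finset V → Set V := fun i e => φ' e ∪ ⋃ ξ : Set.Iic i, g e ξ
  have hψ : ∀ i e, #(ψ i e) < μ := fun i e =>
    mk_union_lt hμ.le (hφ' e) (hunion _ (hIic i) fun ξ => hsing _ (hg e ξ))
  obtain ⟨M, hM⟩ := exists_of_wellFoundedLT (I := I) (α := Set V) (fun i M x =>
    ¬ Hindered D (Y ∪ N i M) (Z ∪ N i M) → #(N i M) < μ →
    N i M ∪ u i ⊆ x ∧ #x < μ ∧ (∀ e : Finset V, ↑e ⊆ x → ψ i e ⊆ x) ∧
      Link D (Y ∪ N i M) (Z ∪ N i M) x)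
    (by
      intro i M M' x h hP
      have : N i M = N i M' := Set.iUnion_congr fun j => h j j.2
      rwa [← this])
    (by
      intro i M _
      by_cases h : ¬ Hindered D (Y ∪ N i M) (Z ∪ N i M) ∧ #(N i M) < μ
      · obtain ⟨x, hx⟩ := Linkable.exists_lt hμ hreg ih h.1 (hψ i)
          (mk_union_lt hμ.le h.2 (hsing _ (hu i)))
        exact ⟨x, fun _ _ => hx⟩
      · exact ⟨∅, fun h1 h2 => absurd ⟨h1, h2⟩ h⟩)
  have hN : ∀ i, ¬ Hindered D (Y ∪ N i M) (Z ∪ N i M) ∧ #(N i M) < μ := by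
    intro i
    induction i using WellFoundedLT.induction with
    | ind i hi =>
      have hj : ∀ j < i, _ := fun j hj => hM j (hi j hj).1 (hi j hj).2
      have hcard : #(N i M) < μ := hunion _ (hIio i) fun j => (hj j j.2).2.1
      refine ⟨?_, hcard⟩
      rcases isEmpty_or_nonempty (Set.Iio i) with hemp | hne
      · have : N i M = ∅ := Set.iUnion_of_empty _
        simpa [this] using hun
      · refine hgood _ hcard fun e he => ?_
        have hmono : Monotone fun j : Set.Iio i => M j := by
          intro j j' hjj
          rcases hjj.eq_or_lt with rfl | hlt
          · exact le_rfl
          · exact (Set.subset_iUnion (fun x : Set.Iio (j' : I) => M x) ⟨j, hlt⟩).trans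
              (Set.subset_union_left.trans (hj j' j'.2).1)
        obtain ⟨j, hje⟩ := exists_finset_subset hmono he
        exact (Set.subset_union_left.trans ((hj j j.2).2.2.1 e hje)).trans
          (Set.subset_iUnion (fun j : Set.Iio i => M j) j)
  have hM' : ∀ i, _ := fun i => hM i (hN i).1 (hN i).2
  have hmono : Monotone M := by
    intro j j' hjj
    rcases hjj.eq_or_lt with rfl | hlt
    · exact le_rfl
    · exact (Set.subset_iUnion (fun x : Set.Iio (j' : I) => M x) ⟨j, hlt⟩).trans
        (Set.subset_union_left.trans (hM' j').1)
  refine ⟨⋃ i, M i, ?_, ?_, fun e he => ?_, ?_⟩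
  · rw [← hu']
    exact Set.iUnion_mono fun i => Set.subset_union_right.trans (hM' i).1
  · exact mk_iUnion_le_of_le hμ.le hI.le fun i => (hM' i).2.1.le
  · obtain ⟨j, hje⟩ := exists_finset_subset hmono he
    rw [← hg' e]
    refine Set.iUnion_subset fun ξ => ?_
    refine LE.le.trans ?_ (Set.subset_iUnion M (max j ξ))
    refine LE.le.trans ?_ ((hM' (max j ξ)).2.2.1 e (hje.trans (hmono (le_max_left _ _))))
    exact (Set.subset_iUnion (fun x : Set.Iic (max j ξ) => g e x) ⟨ξ, le_max_right _ _⟩).trans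
      Set.subset_union_right
  · refine Link.iUnion (N := fun i => N i M) (fun i => ?_) fun i => (hM' i).2.2.2
    simp only [N, Set.iUnion_subtype, Set.mem_Iio]

/-- A set of size at most `ν` is filtered by sets of size at most `σ`, for `σ < ν`. -/
theorem exists_filtration {ν : Cardinal.{u}} {S : Set V} (hS : #S ≤ ν) :
    ∃ g : Cardinal.{u} → Set V, (∀ σ, #(g σ) ≤ σ) ∧ ∀ v ∈ S, ∃ ρ < ν, ∀ σ, ρ < σ → v ∈ g σ := by
  have hle : #S ≤ #ν.ord.ToType := by simpa using hS
  obtain ⟨j⟩ := hle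
  let o : S → Ordinal.{u} := fun v => Ordinal.ToType.mk.symm (j v)
  have ho : Function.Injective o := fun v w h =>
    j.injective (Ordinal.ToType.mk.symm.injective (Subtype.ext h))
  refine ⟨fun σ => {v | ∃ h : v ∈ S, (o ⟨v, h⟩).card < σ}, fun σ => ?_, fun v hv => ?_⟩
  · have h := mk_le_of_injective (α := ULift.{u + 1} {v | ∃ h : v ∈ S, (o ⟨v, h⟩).card < σ})
      (β := Set.Iio σ.ord) (f := fun v => ⟨o ⟨v.down, v.down.2.1⟩, lt_ord.2 v.down.2.2⟩)
      fun v w h => by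
        have h' : o ⟨v.down, v.down.2.1⟩ = o ⟨w.down, w.down.2.1⟩ :=
          congrArg (fun x : Set.Iio σ.ord => (x : Ordinal.{u})) h
        exact ULift.ext _ _ (Subtype.ext (Subtype.mk.inj (ho h')))
    rw [mk_Iio_ordinal, mk_uLift, card_ord] at h
    exact lift_le.1 h
  · exact ⟨_, lt_ord.1 (Ordinal.ToType.mk.symm (j ⟨v, hv⟩)).2, fun σ hσ => ⟨hv, hσ⟩⟩

theorem exists_cofinal_family {μ : Cardinal.{u}} (hμ : Order.IsSuccLimit μ) {I : Type u}
    (hI : #I = μ.ord.cof) : ∃ c : I → Cardinal.{u}, (∀ i, c i < μ) ∧ ∀ ρ < μ, ∃ i, ρ < c i := by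
  obtain ⟨s, hs, hcard⟩ := Order.exists_cof_eq μ.ord.ToType
  rw [Ordinal.cof_toType, ← hI] at hcard
  obtain ⟨j⟩ := Cardinal.eq.1 hcard
  let o : μ.ord.ToType → Ordinal.{u} := fun v => Ordinal.ToType.mk.symm v
  refine ⟨fun i => (o (j.symm i)).card, fun i => lt_ord.1
    (Ordinal.ToType.mk.symm (j.symm i : μ.ord.ToType)).2, fun ρ hρ => ?_⟩
  obtain ⟨y, hy, hle⟩ := hs (Ordinal.ToType.mk ⟨(Order.succ ρ).ord, ord_lt_ord.2 (hμ.succ_lt hρ)⟩)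
  refine ⟨j ⟨y, hy⟩, ?_⟩
  dsimp only
  rw [Equiv.symm_apply_apply]
  have : (Order.succ ρ).ord ≤ o y := by
    have h := Ordinal.ToType.mk.symm.monotone hle
    rwa [OrderIso.symm_apply_apply] at h
  exact (Order.lt_succ ρ).trans_le (ord_le.1 this)

theorem linkable_of_isSingular {μ : Cardinal.{u}} (hμ : ℵ₀ < μ) (hsing : μ.IsSingular)
    (ih : ∀ ρ, ℵ₀ ≤ ρ → ρ < μ → Linkable D ρ) : Linkable D μ := by
  classical
  intro Y Z hun φ hφ U hU
  set θ := μ.ord.cof with hθ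
  have hθ0 : ℵ₀ ≤ θ := Ordinal.aleph0_le_cof_iff.2 (Ordinal.one_lt_cof_iff.2 (isSuccLimit_ord hμ.le))
  have hθμ : θ < μ := hsing.cof_ord_lt
  obtain ⟨I, _, _, _, hI, hIio, hIoi⟩ := exists_wellOrder θ hθ0
  obtain ⟨c, hc, hcof⟩ := exists_cofinal_family hsing.isSuccLimit hI
  let ν : I → Cardinal.{u} := fun i => max θ (⨆ j : Set.Iio i, c j)
  let σ : I → Cardinal.{u} := fun i => max (ν i) (c i)
  have hθν : ∀ i, θ ≤ ν i := fun i => le_max_left _ _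
  have hνσ : ∀ i, ν i ≤ σ i := fun i => le_max_left _ _
  have hν0 : ∀ i, ℵ₀ ≤ ν i := fun i => hθ0.trans (hθν i)
  have hσ0 : ∀ i, ℵ₀ ≤ σ i := fun i => (hν0 i).trans (hνσ i)
  have hνμ : ∀ i, ν i < μ := fun i =>
    max_lt hθμ (iSup_lt_of_lt_cof_ord (hIio i) fun j => hc j)
  have hσμ : ∀ i, σ i < μ := fun i => max_lt (hνμ i) (hc i)
  have hσν : ∀ j i, j < i → σ j ≤ ν i := by
    intro j i hji
    have hb : ∀ i : I, BddAbove (Set.range fun j : Set.Iio i => c j) := fun i => bddAbove_of_small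
    have hcj : ∀ k : Set.Iio i, c k ≤ ν i := fun k => (le_ciSup (hb i) k).trans (le_max_right _ _)
    refine max_le (max_le (hθν i) (ciSup_le' fun k => ?_)) (hcj ⟨j, hji⟩)
    exact hcj ⟨k, lt_trans (Set.mem_Iio.1 k.2) hji⟩
  have hσm : Monotone σ := fun j i hji => hji.eq_or_lt.elim (fun h => h ▸ le_rfl)
    fun h => (hσν j i h).trans (hνσ i)
  have hσcof : ∀ ρ < μ, ∃ i, ρ < σ i := fun ρ hρ => (hcof ρ hρ).imp fun i hi =>
    hi.trans_le (le_max_right _ _)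
  have hνcof : ∀ i j, j < i → ∀ ρ < ν i, ∃ j < i, ρ < σ j := by
    intro i j hj ρ hρ
    rcases lt_max_iff.1 hρ with h | h
    · exact ⟨j, hj, h.trans_le ((hθν j).trans (hνσ j))⟩
    · obtain ⟨k, hk⟩ := exists_lt_of_lt_ciSup' h
      exact ⟨k, k.2, hk.trans_le (le_max_right _ _)⟩
  have : ∀ i, ∃ φ' : Finset V → Set V, (∀ e, #(φ' e) < Order.succ (ν i)) ∧
      ∀ M : Set V, #M < Order.succ (ν i) → (∀ e : Finset V, ↑e ⊆ M → φ' e ⊆ M) →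
        ¬ Hindered D (Y ∪ M) (Z ∪ M) := fun i =>
    exists_closure_unhindered ((hν0 i).trans_lt (Order.lt_succ _)) (isRegular_succ (hν0 i)) hun
  choose φ' hφ' hgood using this
  choose g hg hg' using fun i e => exists_filtration (Order.lt_succ_iff.1 (hφ' i e))
  choose t ht ht' using fun e => exists_filtration (hφ e)
  obtain ⟨w, hw, hw'⟩ := exists_filtration hU
  let N : I → (I → Set V) → Set V := fun i M => ⋃ j : Set.Iio i, M j
  let ψ : I → Finset V → Set V := fun j e => (⋃ i, g i e (σ j)) ∪ t e (σ j)
  have hψ : ∀ j e, #(ψ j e) ≤ σ j := fun j e => mk_union_le (hσ0 j)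
    (mk_iUnion_le_of_le (hσ0 j) (hI.le.trans ((hθν j).trans (hνσ j))) fun i => hg i e _) (ht e _)
  obtain ⟨M, hM⟩ := exists_of_wellFoundedLT (I := I) (α := Set V) (fun i M x =>
    ¬ Hindered D (Y ∪ N i M) (Z ∪ N i M) → #(N i M) ≤ ν i →
    N i M ∪ w (σ i) ⊆ x ∧ #x ≤ σ i ∧ (∀ e : Finset V, ↑e ⊆ x → ψ i e ⊆ x) ∧
      Link D (Y ∪ N i M) (Z ∪ N i M) x)
    (by
      intro i M M' x h hP
      have : N i M = N i M' := Set.iUnion_congr fun j => h j j.2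
      rwa [← this])
    (by
      intro i M _
      by_cases h : ¬ Hindered D (Y ∪ N i M) (Z ∪ N i M) ∧ #(N i M) ≤ ν i
      · obtain ⟨x, hx⟩ := ih (σ i) (hσ0 i) (hσμ i) _ _ h.1 (ψ i) (hψ i) (N i M ∪ w (σ i))
          (mk_union_le (hσ0 i) (h.2.trans (hνσ i)) (hw _))
        exact ⟨x, fun _ _ => hx⟩
      · exact ⟨∅, fun h1 h2 => absurd ⟨h1, h2⟩ h⟩)
  have hN : ∀ i, ¬ Hindered D (Y ∪ N i M) (Z ∪ N i M) ∧ #(N i M) ≤ ν i := by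
    intro i
    induction i using WellFoundedLT.induction with
    | ind i hi =>
      have hj : ∀ j < i, _ := fun j hj => hM j (hi j hj).1 (hi j hj).2
      have hcard : #(N i M) ≤ ν i := mk_iUnion_le_of_le (hν0 i) ((hIio i).le.trans (hθν i))
        fun j => (hj j j.2).2.1.trans (hσν j i j.2)
      refine ⟨?_, hcard⟩
      rcases isEmpty_or_nonempty (Set.Iio i) with hemp | hne
      · have : N i M = ∅ := Set.iUnion_of_empty _
        simpa [this] using hun
      · refine hgood i _ (Order.lt_succ_iff.2 hcard) fun e he v hv => ?_
        have hmono : Monotone fun j : Set.Iio i => M j := by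
          intro j j' hjj
          rcases hjj.eq_or_lt with rfl | hlt
          · exact le_rfl
          · exact (Set.subset_iUnion (fun x : Set.Iio (j' : I) => M x) ⟨j, hlt⟩).trans
              (Set.subset_union_left.trans (hj j' j'.2).1)
        obtain ⟨j, hje⟩ := exists_finset_subset hmono he
        obtain ⟨ρ, hρ, hρ'⟩ := hg' i e v hv
        obtain ⟨k, hk, hρk⟩ := hνcof i j j.2 ρ hρ
        let m : Set.Iio i := max j ⟨k, hk⟩
        have hkm : k ≤ m := (le_max_right j ⟨k, hk⟩ : (⟨k, hk⟩ : Set.Iio i) ≤ m)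
        refine Set.mem_iUnion.2 ⟨m, (hj m m.2).2.2.1 e (hje.trans (hmono (le_max_left _ _))) ?_⟩
        exact Or.inl (Set.mem_iUnion.2 ⟨i, hρ' _ (hρk.trans_le (hσm hkm))⟩)
  have hM' : ∀ i, _ := fun i => hM i (hN i).1 (hN i).2
  have hmono : Monotone M := by
    intro j j' hjj
    rcases hjj.eq_or_lt with rfl | hlt
    · exact le_rfl
    · exact (Set.subset_iUnion (fun x : Set.Iio (j' : I) => M x) ⟨j, hlt⟩).trans
        (Set.subset_union_left.trans (hM' j').1)
  refine ⟨⋃ i, M i, fun v hv => ?_, ?_, fun e he v hv => ?_, ?_⟩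
  · obtain ⟨ρ, hρ, hρ'⟩ := hw' v hv
    obtain ⟨i, hi⟩ := hσcof ρ hρ
    exact Set.mem_iUnion.2 ⟨i, (hM' i).1 (Or.inr (hρ' _ hi))⟩
  · exact mk_iUnion_le_of_le hμ.le (hI.trans_le hθμ.le) fun i => (hM' i).2.1.trans (hσμ i).le
  · obtain ⟨j, hje⟩ := exists_finset_subset hmono he
    obtain ⟨ρ, hρ, hρ'⟩ := ht' e v hv
    obtain ⟨i, hi⟩ := hσcof ρ hρ
    refine Set.mem_iUnion.2 ⟨max j i,
      (hM' _).2.2.1 e (hje.trans (hmono (le_max_left _ _))) (Or.inr ?_)⟩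
    exact hρ' _ (hi.trans_le (hσm (le_max_right _ _)))
  · refine Link.iUnion (N := fun i => N i M) (fun i => ?_) fun i => (hM' i).2.2.2
    simp only [N, Set.iUnion_subtype, Set.mem_Iio]

theorem linkable {μ : Cardinal.{u}} (hμ : ℵ₀ ≤ μ) : Linkable D μ := by
  induction μ using WellFoundedLT.induction with
  | ind μ ih =>
    rcases hμ.eq_or_lt with rfl | hlt
    · exact linkable_aleph0
    · rcases isRegular_or_isSingular hμ with h | h
      · exact linkable_of_isRegular hlt h fun ρ h0 hρ => ih ρ hρ h0
      · exact linkable_of_isSingular hlt h fun ρ h0 hρ => ih ρ hρ h0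

theorem link_univ (hun : ¬ Hindered D Y Z) : Link D Y Z Set.univ := by
  obtain ⟨M, hM, -, -, h⟩ := linkable (le_max_left ℵ₀ #V) Y Z hun (fun _ => ∅) (by simp)
    Set.univ (by simp)
  rwa [Set.univ_subset_iff.1 hM] at h

theorem rel_of_mem_zip_tail {r : V → V → Prop} {l : List V} (h : l.IsChain r) :
    ∀ e ∈ l.zip l.tail, r e.1 e.2 := by
  induction l with
  | nil => simp
  | cons x l ih =>
    cases l with
    | nil => simp
    | cons y l =>
      rw [List.isChain_cons_cons] at h
      intro e he
      rw [List.tail_cons, List.zip_cons_cons, List.mem_cons] at he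
      rcases he with rfl | he
      · exact h.1
      · exact ih h.2 e he

theorem nodup_of_forall_append {l : List V}
    (h : ∀ l₁ x l₂, l = l₁ ++ x :: l₂ → x ∉ l₂) : l.Nodup := by
  induction l with
  | nil => simp
  | cons x l ih =>
    rw [List.nodup_cons]
    refine ⟨h [] x l rfl, ih fun l₁ y l₂ hl => h (x :: l₁) y l₂ (by rw [hl, List.cons_append])⟩

/-- A shortest connection from `X` to `Y` is an `X→Y` path. -/
theorem Conn.exists_isXYPath {D : Set (V × V)} {X Y U : Set V} {a b : V}
    (h : Conn (fun x y => (x, y) ∈ D) U a b) (haU : a ∈ U) (ha : a ∈ X) (hb : b ∈ Y) :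
    ∃ Q, IsXYPath D X Y Q ∧ Q.vertexSet ⊆ U := by
  let Good : List V → Prop := fun l => l.IsChain (fun x y => (x, y) ∈ D) ∧ (∀ x ∈ l, x ∈ U) ∧
    ∃ hl : l ≠ [], l.head hl ∈ X ∧ l.getLast hl ∈ Y
  have hex : ∃ l, Good l := by
    obtain ⟨l, hl, hlast⟩ := List.exists_isChain_cons_of_relationReflTransGen h
    refine ⟨a :: l, hl.imp fun x y h => h.1, ?_, by simp, ha, hlast ▸ hb⟩
    have hmem : ∀ (l : List V) (a : V), (a :: l).IsChain (fun x y => (x, y) ∈ D ∧ y ∈ U) →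
        a ∈ U → ∀ x ∈ a :: l, x ∈ U := by
      intro l
      induction l with
      | nil => simp
      | cons y l ih =>
        intro a hl ha x hx
        rw [List.isChain_cons_cons] at hl
        rcases List.mem_cons.1 hx with rfl | hx
        · exact ha
        · exact ih y hl.2 hl.1.2 x hx
    exact hmem l a hl haU
  obtain ⟨l, hl, hmin⟩ := WellFounded.has_min (measure List.length).wf {l | Good l} hex
  replace hmin : ∀ l', Good l' → l.length ≤ l'.length := fun l' h' => not_lt.1 (hmin l' h')
  obtain ⟨hch, hU, hne, hX, hY⟩ := hl
  have hhead : ∀ l₁ x l₂, l = l₁ ++ x :: l₂ → x ∈ X → l₁ = [] := by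
    rintro l₁ x l₂ rfl hx
    have := hmin (x :: l₂) ⟨(List.isChain_append.1 hch).2.1, fun y hy => hU y (by simp_all),
      by simp, hx, by simpa using hY⟩
    rw [List.length_append] at this
    exact List.length_eq_zero_iff.1 (by omega)
  have hlast : ∀ l₁ x l₂, l = l₁ ++ x :: l₂ → x ∈ Y → l₂ = [] := by
    rintro l₁ x l₂ rfl hx
    have hspl : l₁ ++ x :: l₂ = (l₁ ++ [x]) ++ l₂ := by simp
    have := hmin (l₁ ++ [x]) ⟨(List.isChain_append.1 (hspl ▸ hch)).1,
      fun y hy => hU y (by rw [hspl]; exact List.mem_append_left _ hy), by simp, ?_, by simpa using hx⟩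
    · rw [List.length_append, List.length_append, List.length_cons, List.length_singleton] at this
      exact List.length_eq_zero_iff.1 (by omega)
    · cases l₁ <;> simpa using hX
  have hnodup : l.Nodup := by
    refine nodup_of_forall_append fun l₁ x l₂ he hx => ?_
    obtain ⟨m, n, rfl⟩ := List.append_of_mem hx
    subst he
    have := hmin (l₁ ++ x :: n) ⟨?_, fun y hy => hU y (by simp at hy ⊢; tauto), by simp, ?_, ?_⟩
    · simp only [List.length_append, List.length_cons] at this
      omega
    · have h1 := List.isChain_split.1 hch
      exact List.isChain_split.2 ⟨h1.1, (List.isChain_split.1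
        (show (x :: m ++ x :: n).IsChain _ from h1.2)).2⟩
    · cases l₁ <;> simpa using hX
    · simpa using hY
  refine ⟨⟨l, hne, hnodup⟩, ⟨fun e he => rel_of_mem_zip_tail hch e he, ?_, ?_⟩, hU⟩
  · refine subset_antisymm ?_ (Set.singleton_subset_iff.2 ⟨List.head_mem hne, hX⟩)
    rintro x ⟨hxl, hx⟩
    obtain ⟨l₁, l₂, he⟩ := List.append_of_mem (show x ∈ l from hxl)
    obtain rfl := hhead l₁ x l₂ he hx
    subst he
    rfl
  · refine subset_antisymm ?_ (Set.singleton_subset_iff.2 ⟨List.getLast_mem hne, hY⟩)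
    rintro x ⟨hxl, hx⟩
    obtain ⟨l₁, l₂, he⟩ := List.append_of_mem (show x ∈ l from hxl)
    obtain rfl := hlast l₁ x l₂ he hx
    subst he
    simp [DiPath.last]

theorem exists_mem_of_edges_subset {D : Set (V × V)} {S : Set V}
    (hR : ∀ x ∈ R, ∀ y, (x, y) ∈ D → y ∈ R ∪ S) (l : List V) (hne : l ≠ [])
    (hl : ∀ e ∈ l.zip l.tail, e ∈ D) (hhead : l.head hne ∈ R ∪ S) :
    l.getLast hne ∈ R ∨ ∃ x ∈ l, x ∈ S := by
  induction l with
  | nil => exact absurd rfl hne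
  | cons x l ih =>
    rcases hhead with hx | hx
    swap
    · exact Or.inr ⟨x, List.mem_cons_self, hx⟩
    cases l with
    | nil => exact Or.inl hx
    | cons y l =>
      have hzip : (x :: y :: l).zip (x :: y :: l).tail = (x, y) :: (y :: l).zip (y :: l).tail := rfl
      rw [hzip] at hl
      have := ih (by simp) (fun e he => hl e (List.mem_cons_of_mem _ he))
        (hR x hx y (hl _ List.mem_cons_self))
      rw [List.getLast_cons_cons]
      exact this.imp id fun ⟨z, hz, hzS⟩ => ⟨z, List.mem_cons_of_mem _ hz, hzS⟩

/-- The backward orbit of `s` under the wave function `f`, up to the first source. -/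
def orbit (D : V → V → Prop) (Z R : Set V) (f : V → V) (s : V) : Set V :=
  {w | Relation.ReflTransGen (fun v w => v ∈ nbr D R ∧ v ∉ Z ∧ w = f v) s w}

theorem IsWave.eq_or_mem_of_mem_orbit (h : IsWave D Y Z R f) {s w : V}
    (hw : w ∈ orbit D Z R f s) : w = s ∨ w ∈ R := by
  rcases Relation.ReflTransGen.cases_tail hw with rfl | ⟨v, -, h1, h2, rfl⟩
  · exact Or.inl rfl
  · exact Or.inr (h.maps v h1 h2)

theorem IsWave.eq_of_mem_orbit (h : IsWave D Y Z R f) {s s' w : V} (hs : s ∉ R) (hs' : s' ∉ R)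
    (hw : w ∈ orbit D Z R f s) (hw' : w ∈ orbit D Z R f s') : s = s' := by
  induction hw with
  | refl => exact (h.eq_or_mem_of_mem_orbit hw').resolve_right hs
  | tail _ hvw ih =>
    obtain ⟨h1, h2, rfl⟩ := hvw
    rcases Relation.ReflTransGen.cases_tail hw' with he | ⟨v', hv', h1', h2', he⟩
    · exact absurd (he ▸ h.maps _ h1 h2) hs'
    · exact ih (h.inj _ h1' h2' _ h1 h2 he.symm ▸ hv')

theorem IsWave.conn_orbit (h : IsWave D Y Z R f) {s w : V} (hw : w ∈ orbit D Z R f s) :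
    Conn D (orbit D Z R f s) w s := by
  induction hw with
  | refl => exact .refl
  | tail hv hvw ih =>
    obtain ⟨h1, h2, rfl⟩ := hvw
    rcases h.adj _ h1 h2 with he | he
    · rwa [he]
    · exact .head ⟨he, hv⟩ ih

theorem IsWave.exists_mem_orbit (h : IsWave D Y Z R f) {s : V} (hs : s ∈ Z ∪ nbr D R)
    (hsR : s ∉ R) : ∃ a ∈ orbit D Z R f s, a ∈ Z := by
  by_contra! hc
  have hnbr : ∀ w ∈ orbit D Z R f s, w ∈ nbr D R := fun w hw => by
    rcases h.eq_or_mem_of_mem_orbit hw with rfl | hw'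
    · exact hs.resolve_left (hc w hw)
    · exact subset_nbr D R hw'
  have hmem : ∀ n, f^[n] s ∈ orbit D Z R f s := by
    intro n
    induction n with
    | zero => exact .refl
    | succ n ih =>
      rw [Function.iterate_succ_apply']
      exact .tail ih ⟨hnbr _ ih, hc _ ih, rfl⟩
  have hR : ∀ n, f^[n + 1] s ∈ R := fun n => by
    rw [Function.iterate_succ_apply']
    exact h.maps _ (hnbr _ (hmem n)) (hc _ (hmem n))
  refine h.noRay (fun n => f^[n] s) (fun m n hmn => ?_) fun n =>
    ⟨hnbr _ (hmem n), hc _ (hmem n), Function.iterate_succ_apply' f n s⟩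
  dsimp only at hmn
  induction m generalizing n with
  | zero =>
    cases n with
    | zero => rfl
    | succ n => exact absurd (hmn ▸ hR n : f^[0] s ∈ R) hsR
  | succ m ih =>
    cases n with
    | zero => exact absurd (hmn ▸ hR m : f^[0] s ∈ R) hsR
    | succ n =>
      rw [Function.iterate_succ_apply', Function.iterate_succ_apply'] at hmn
      rw [ih n (h.inj _ (hnbr _ (hmem m)) (hc _ (hmem m)) _ (hnbr _ (hmem n)) (hc _ (hmem n)) hmn)]

/-- The elements of `(Z ∪ nbr D R) \ R`, for the largest wave region `R`, can be joined from `Z`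
and to `Y` inside pairwise disjoint sets. -/
theorem exists_disjoint_conn (D : V → V → Prop) (Y Z : Set V) : ∃ U : V → Set V,
    (∀ s ∈ (Z ∪ nbr D (waveMax D Y Z)) \ waveMax D Y Z, s ∈ U s ∧
      ∃ a ∈ U s, a ∈ Z ∧ ∃ b ∈ Y, Conn D (U s) a b) ∧
    ((Z ∪ nbr D (waveMax D Y Z)) \ waveMax D Y Z).PairwiseDisjoint U := by
  classical
  obtain ⟨f, hf⟩ := exists_isWave_waveMax D Y Z
  obtain ⟨P, hP1, hP2⟩ := link_univ (not_hindered_quotient (D := D) (Y := Y) (Z := Z))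
  set R := waveMax D Y Z
  have hfwd : ∀ s ∈ (Z ∪ nbr D R) \ R, s ∉ Y → _ := fun s hs hY =>
    hP1 s trivial hs.1 fun h => h.elim hY hs.2
  let P' : V → Set V := fun s => if s ∈ Y then {s} else P s
  have hP'1 : ∀ s ∈ (Z ∪ nbr D R) \ R, s ∈ P' s ∧ (∀ q ∈ P' s, q ∈ Z ∪ nbr D R → q = s) ∧
      ∃ b ∈ Y, Conn D (P' s) s b := by
    intro s hs
    by_cases hY : s ∈ Y
    · simp only [P', if_pos hY]
      exact ⟨rfl, fun q hq _ => hq, s, hY, .refl⟩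
    · simp only [P', if_neg hY]
      obtain ⟨h1, -, h3, b, ⟨hb, hbP⟩, h4⟩ := hfwd s hs hY
      refine ⟨h1, h3, b, hb.resolve_right fun hbR => ?_, h4⟩
      exact hs.2 (h3 b hbP (Or.inr (subset_nbr D R hbR)) ▸ hbR)
  have hP'2 : ∀ s ∈ (Z ∪ nbr D R) \ R, ∀ s' ∈ (Z ∪ nbr D R) \ R, ∀ x ∈ P' s, x ∈ P' s' → s = s' := by
    intro s hs s' hs' x hx hx'
    by_cases hY : s ∈ Y
    · obtain rfl : x = s := Set.mem_singleton_iff.1 (by simpa only [P', if_pos hY] using hx)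
      exact (hP'1 s' hs').2.1 x hx' hs.1
    by_cases hY' : s' ∈ Y
    · obtain rfl : x = s' := Set.mem_singleton_iff.1 (by simpa only [P', if_pos hY'] using hx')
      exact ((hP'1 s hs).2.1 x hx hs'.1).symm
    simp only [P', if_neg hY] at hx
    simp only [P', if_neg hY'] at hx'
    by_contra hne
    exact Set.disjoint_left.1 (hP2 s trivial hs.1 (fun h => h.elim hY hs.2) s' trivial hs'.1
      (fun h => h.elim hY' hs'.2) hne) hx hx'
  have hcross : ∀ s ∈ (Z ∪ nbr D R) \ R, ∀ s' ∈ (Z ∪ nbr D R) \ R, ∀ x ∈ orbit D Z R f s,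
      x ∈ P' s' → s = s' := by
    intro s hs s' hs' x hx hx'
    rcases hf.eq_or_mem_of_mem_orbit hx with rfl | hR
    · exact (hP'1 s' hs').2.1 x hx' hs.1
    · exact absurd ((hP'1 s' hs').2.1 x hx' (Or.inr (subset_nbr D R hR)) ▸ hR) hs'.2
  refine ⟨fun s => orbit D Z R f s ∪ P' s, fun s hs => ?_, fun s hs s' hs' hne => ?_⟩
  · obtain ⟨h1, -, b, hb, h2⟩ := hP'1 s hs
    obtain ⟨a, ha, haZ⟩ := hf.exists_mem_orbit hs.1 hs.2
    exact ⟨Or.inr h1, a, Or.inl ha, haZ, b, hb, ((hf.conn_orbit ha).mono Set.subset_union_left).trans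
      (h2.mono Set.subset_union_right)⟩
  · refine Set.disjoint_left.2 ?_
    rintro x (hx | hx) (hx' | hx')
    · exact hne (hf.eq_of_mem_orbit hs.2 hs'.2 hx hx')
    · exact hne (hcross s hs s' hs' x hx hx')
    · exact hne (hcross s' hs' s hs x hx' hx).symm
    · exact hne (hP'2 s hs s' hs' x hx hx')

end

/-- (Aharoni–Berger) For every digraph `D` and vertex sets `X`, `Y`, there is a system
`Ps` of disjoint `X→Y` paths of `D` such that choosing exactly one vertex from each of
its paths one gets a set separating `Y` from `X` in `D`. -/
theorem aharoni_berger {V : Type u} (D : Set (V × V)) (X Y : Set V) :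
    ∃ Ps, DisjXYSystem D X Y Ps ∧
      ∃ sel : DiPath V → V, (∀ P ∈ Ps, sel P ∈ P.vertexSet) ∧
        ∀ Q : DiPath V, IsXYPath D X Y Q → ((sel '' Ps) ∩ Q.vertexSet).Nonempty := by
  classical
  let r : V → V → Prop := fun x y => (x, y) ∈ D
  obtain ⟨U, hU, hdisj⟩ := exists_disjoint_conn r Y X
  obtain ⟨f, hf⟩ := exists_isWave_waveMax r Y X
  set R := waveMax r Y X
  set S := (X ∪ nbr r R) \ R with hS
  have hsep : ∀ Q, IsXYPath D X Y Q → ∃ s ∈ S, s ∈ Q.vertexSet := by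
    intro Q hQ
    have hX : Q.first ∈ X := (hQ.2.1.symm.subset rfl : Q.first ∈ Q.vertexSet ∩ X).2
    have hY : Q.last ∈ Y := (hQ.2.2.symm.subset rfl : Q.last ∈ Q.vertexSet ∩ Y).2
    have hRS : R ∪ S = X ∪ nbr r R := by
      rw [hS, Set.union_sdiff_self, Set.union_eq_self_of_subset_left]
      exact (subset_nbr r R).trans Set.subset_union_right
    rcases exists_mem_of_edges_subset (R := R) (S := S)
      (fun x hx y hxy => hRS ▸ Or.inr ⟨x, hx, Or.inr hxy⟩) Q.verts Q.ne hQ.1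
      (hRS ▸ Or.inl hX) with h | ⟨s, hs, hsS⟩
    · exact absurd hY (hf.disj _ h)
    · exact ⟨s, hsS, hs⟩
  have hpath : ∀ s, ∃ Q, s ∈ S → IsXYPath D X Y Q ∧ Q.vertexSet ⊆ U s := by
    intro s
    by_cases hs : s ∈ S
    · obtain ⟨-, a, haU, haX, b, hb, hab⟩ := hU s hs
      obtain ⟨Q, hQ⟩ := hab.exists_isXYPath haU haX hb
      exact ⟨Q, fun _ => hQ⟩
    · exact ⟨⟨[s], by simp, by simp⟩, fun h => absurd h hs⟩
  choose Q hQ using hpath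
  have hmem : ∀ s ∈ S, s ∈ (Q s).vertexSet := by
    intro s hs
    obtain ⟨t, ht, htQ⟩ := hsep _ (hQ s hs).1
    have hst : s = t :=
      hdisj.elim hs ht (Set.not_disjoint_iff.2 ⟨t, (hQ s hs).2 htQ, (hU t ht).1⟩)
    rwa [← hst] at htQ
  have hsel : ∀ P : DiPath V, ∃ v, ∀ s ∈ S, Q s = P → v = s := by
    intro P
    by_cases h : ∃ s ∈ S, Q s = P
    · obtain ⟨t, ht, rfl⟩ := h
      refine ⟨t, fun s hs hst => hdisj.elim ht hs (Set.not_disjoint_iff.2 ⟨t, (hU t ht).1, ?_⟩)⟩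
      exact (hQ s hs).2 (hst ▸ hmem t ht)
    · exact ⟨P.first, fun s hs hsP => absurd ⟨s, hs, hsP⟩ h⟩
  choose sel hsel using hsel
  have hselQ : ∀ s ∈ S, sel (Q s) = s := fun s hs => hsel _ s hs rfl
  refine ⟨Q '' S, ⟨?_, ?_⟩, sel, ?_, fun P hP => ?_⟩
  · rintro _ ⟨s, hs, rfl⟩
    exact (hQ s hs).1
  · rintro _ ⟨s, hs, rfl⟩ _ ⟨t, ht, rfl⟩ hne
    exact Set.disjoint_iff_inter_eq_empty.1 ((hdisj hs ht fun h => hne (h ▸ rfl)).mono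
      (hQ s hs).2 (hQ t ht).2)
  · rintro _ ⟨s, hs, rfl⟩
    rw [hselQ s hs]
    exact hmem s hs
  · obtain ⟨s, hs, hsP⟩ := hsep P hP
    exact ⟨s, ⟨Q s, ⟨s, hs, rfl⟩, hselQ s hs⟩, hsP⟩

end FlamePaper
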